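/- arXiv:1602.00717 — 5 statements merged into one kernel-verified Lean document; each statement's English description precedes it below -/
import Mathlib

section
/- Let n ≥ 3 and let Ω ⊂ ℝⁿ be a bounded open set whose boundary ∂Ω is Ahlfors regular with constants C₁, C₂. Then Ω satisfies the capacity density condition: there exists a constant c > 0, depending only on n, C₁ and C₂, such that for every Q ∈ ∂Ω and every 0 < r ≤ diam Ω one has cap(B(Q,r) ∩ ∂Ω) ≥ c r^{n−2}, and consequently cap(B(Q,r) ∩ Ωᶜ) ≥ c r^{n−2}. -/
open MeasureTheory Metric Set Filter Bornology
open scoped ENNReal NNReal Topology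

noncomputable section

abbrev En (n : ℕ) : Type := EuclideanSpace ℝ (Fin n)

/-- `∂Ω` is Ahlfors regular with constants `C₁ ≤ C₂`:
`C₁ r^(n-1) ≤ σ(Δ(Q,r)) ≤ C₂ r^(n-1)` for all `Q ∈ ∂Ω`, `0 < r ≤ diam Ω`,
where `σ = H^(n-1)|_{∂Ω}`. -/
def AhlforsRegular (n : ℕ) (Ω : Set (En n)) (C₁ C₂ : ℝ) : Prop :=
  ∀ Q ∈ frontier Ω, ∀ r : ℝ, 0 < r → r ≤ diam Ω →
    ENNReal.ofReal (C₁ * r ^ (n - 1)) ≤ μH[(n : ℝ) - 1] (ball Q r ∩ frontier Ω) ∧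
      μH[(n : ℝ) - 1] (ball Q r ∩ frontier Ω) ≤ ENNReal.ofReal (C₂ * r ^ (n - 1))

/-- The (electrostatic) capacity of a set `K ⊆ ℝⁿ`:
`cap K = inf { ∫ |∇φ|² : φ ∈ C_c^∞(ℝⁿ), K ⊆ interior {φ ≥ 1} }`. -/
def capacity (n : ℕ) (K : Set (En n)) : ℝ :=
  sInf {e : ℝ | ∃ φ : En n → ℝ, ContDiff ℝ (⊤ : ℕ∞) φ ∧ HasCompactSupport φ ∧
    K ⊆ interior {x | 1 ≤ φ x} ∧ e = ∫ x, ‖fderiv ℝ φ x‖ ^ 2}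

/-- Polar coordinates for the lower Lebesgue integral. -/
lemma lintegral_polar (n : ℕ) (hn : 1 ≤ n) (f : En n → ℝ≥0∞) (hf : Measurable f) :
    ∫⁻ x, f x = ∫⁻ ω, (∫⁻ t in Ioi (0 : ℝ), ENNReal.ofReal (t ^ (n - 1)) * f (t • (ω : En n)))
      ∂((volume : Measure (En n)).toSphere) := by
  have hne : Nonempty (Fin n) := ⟨⟨0, hn⟩⟩
  have hdim : Module.finrank ℝ (En n) = n := by simp
  have h0 : MeasurableSet ({0}ᶜ : Set (En n)) := (measurableSet_singleton _).compl
  have hmp := (volume : Measure (En n)).measurePreserving_homeomorphUnitSphereProd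
  rw [hdim] at hmp
  have hemb := (homeomorphUnitSphereProd (En n)).measurableEmbedding
  have hg : Measurable (fun p : sphere (0 : En n) 1 × Ioi (0 : ℝ) =>
      f ((p.2 : ℝ) • (p.1 : En n))) := by
    apply hf.comp
    fun_prop
  calc ∫⁻ x, f x = ∫⁻ x in ({0}ᶜ : Set (En n)), f x := by
        rw [restrict_compl_singleton]
    _ = ∫⁻ x : ({0}ᶜ : Set (En n)), f x ∂(Measure.comap Subtype.val volume) := by
        rw [lintegral_subtype_comap h0]
    _ = ∫⁻ p, f ((p.2 : ℝ) • (p.1 : En n))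
        ∂((volume : Measure (En n)).toSphere.prod (Measure.volumeIoiPow (n - 1))) := by
        rw [← hmp.lintegral_comp hg]
        refine lintegral_congr fun x => ?_
        have hx : ‖(x : En n)‖ ≠ 0 := norm_ne_zero_iff.2 x.2
        simp [homeomorphUnitSphereProd, smul_smul, hx]
    _ = _ := by
        rw [lintegral_prod _ hg.aemeasurable]
        refine lintegral_congr fun ω => ?_
        have hfm : Measurable (fun t : ℝ => f (t • (ω : En n))) := hf.comp (by fun_prop)
        rw [Measure.volumeIoiPow, lintegral_withDensity_eq_lintegral_mul _ (by fun_prop)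
          (g := fun y : Ioi (0 : ℝ) => f ((y : ℝ) • (ω : En n)))
          (hfm.comp measurable_subtype_coe)]
        exact lintegral_subtype_comap measurableSet_Ioi
          (fun t : ℝ => ENNReal.ofReal (t ^ (n - 1)) * f (t • (ω : En n)))

/-- The auxiliary probability density on `(0, ∞)`. -/
def mden (r t : ℝ) : ℝ := √r / (Real.pi * √t * (r + t))

/-- The kernel `1 / (mden r s * s ^ (n-1))`. -/
def wker (n : ℕ) (r s : ℝ) : ℝ := Real.pi * √s * (r + s) / (√r * s ^ (n - 1))

lemma mden_pos {r t : ℝ} (hr : 0 < r) (ht : 0 < t) : 0 < mden r t := by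
  unfold mden; positivity

lemma wker_nonneg {n : ℕ} {r s : ℝ} (hr : 0 < r) (hs : 0 ≤ s) : 0 ≤ wker n r s := by
  unfold wker; positivity

lemma measurable_mden (r : ℝ) : Measurable (mden r) := by
  unfold mden; fun_prop

lemma measurable_wker (n : ℕ) (r : ℝ) : Measurable (wker n r) := by
  unfold wker; fun_prop

lemma wker_mul {n : ℕ} {r t : ℝ} (hr : 0 < r) (ht : 0 < t) :
    t ^ (n - 1) * wker n r t = (mden r t)⁻¹ := by
  unfold wker mden
  have := Real.sqrt_pos.2 hr
  have := Real.sqrt_pos.2 ht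
  field_simp

lemma lintegral_mden {r : ℝ} (hr : 0 < r) :
    ∫⁻ t in Ioi (0 : ℝ), ENNReal.ofReal (mden r t) = 1 := by
  set F : ℝ → ℝ := fun t => 2 / Real.pi * Real.arctan (√t / √r) with hF
  have hsr := Real.sqrt_pos.2 hr
  have hcont : ContinuousWithinAt F (Ici 0) 0 := by
    apply Continuous.continuousWithinAt
    rw [hF]
    fun_prop
  have hder : ∀ x ∈ Ioi (0 : ℝ), HasDerivAt F (mden r x) x := by
    intro x hx
    have hx : 0 < x := hx
    have hsx := Real.sqrt_pos.2 hx
    have h1 := (((Real.hasDerivAt_sqrt hx.ne').div_const (√r)).arctan).const_mul (2 / Real.pi)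
    convert! h1 using 1
    unfold mden
    rw [div_pow, Real.sq_sqrt hx.le, Real.sq_sqrt hr.le]
    have := Real.pi_pos
    have hrr : r = √r * √r := (Real.mul_self_sqrt hr.le).symm
    field_simp
    nlinarith [Real.sq_sqrt hr.le]
  have hpos : ∀ x ∈ Ioi (0 : ℝ), 0 ≤ mden r x := fun x hx => (mden_pos hr hx).le
  have hlim : Tendsto F atTop (𝓝 1) := by
    have h1 : Tendsto (fun t : ℝ => √t / √r) atTop atTop :=
      Real.tendsto_sqrt_atTop.atTop_div_const hsr
    have h2 := (Real.tendsto_arctan_atTop.mono_right nhdsWithin_le_nhds).comp h1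
    have h3 := h2.const_mul (2 / Real.pi)
    convert! h3 using 2
    have := Real.pi_pos
    field_simp
  rw [← ofReal_integral_eq_lintegral_ofReal
    (integrableOn_Ioi_deriv_of_nonneg hcont hder hpos hlim)
    ((ae_restrict_iff' measurableSet_Ioi).2 (Eventually.of_forall hpos)),
    integral_Ioi_of_hasDerivAt_of_nonneg hcont hder hpos hlim]
  simp [hF]

/-- One-dimensional estimate along a ray. -/
lemma ray_estimate (n : ℕ) (φ : En n → ℝ) (hφ : ContDiff ℝ (⊤ : ℕ∞) φ)
    (hc : HasCompactSupport φ) (x ω : En n) (hω : ‖ω‖ = 1) (hx : 1 ≤ φ x) {r : ℝ} (hr : 0 < r) :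
    1 ≤ ∫⁻ t in Ioi (0 : ℝ),
      ENNReal.ofReal (‖fderiv ℝ φ (x - t • ω)‖ ^ 2 * (mden r t)⁻¹) := by
  set f : ℝ → ℝ := fun t => φ (x - t • ω) with hf
  have hd1 : ContDiff ℝ 1 φ := hφ.of_le (by exact_mod_cast le_top)
  have hfd : ContDiff ℝ 1 f := hd1.comp (by fun_prop)
  have hfs : HasCompactSupport f := by
    have hemb : Topology.IsClosedEmbedding (fun t : ℝ => x - t • ω) := by
      apply Isometry.isClosedEmbedding
      apply Isometry.of_dist_eq
      intro a b
      rw [dist_sub_left, dist_eq_norm, ← sub_smul, norm_smul, hω, mul_one]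
      rfl
    exact hc.comp_isClosedEmbedding hemb
  have hmeas : Measurable (fun t : ℝ => ‖fderiv ℝ φ (x - t • ω)‖) := by
    have := (hd1.continuous_fderiv one_ne_zero)
    exact Continuous.measurable (by fun_prop)
  have hder : ∀ t, ‖deriv f t‖ ≤ ‖fderiv ℝ φ (x - t • ω)‖ := by
    intro t
    have h1 : HasDerivAt (fun t : ℝ => x - t • ω) (-ω) t := by
      simpa using ((hasDerivAt_id t).smul_const ω).const_sub x
    have h2 := ((hd1.differentiable one_ne_zero (x - t • ω)).hasFDerivAt).comp_hasDerivAt t h1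
    rw [HasDerivAt.deriv (f := f) h2]
    refine (ContinuousLinearMap.le_opNorm _ _).trans ?_
    simp [hω]
  set A := ∫⁻ t in Ioi (0 : ℝ),
      ENNReal.ofReal (‖fderiv ℝ φ (x - t • ω)‖ ^ 2 * (mden r t)⁻¹) with hA
  have h1 : (1 : ℝ≥0∞) ≤ ENNReal.ofReal (1 / 2) * A + ENNReal.ofReal (1 / 2) * 1 := by
    calc (1 : ℝ≥0∞) ≤ ‖∫ t in Ioi (0 : ℝ), deriv f t‖ₑ := by
          rw [HasCompactSupport.integral_Ioi_deriv_eq hfd hfs 0, ← ofReal_norm]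
          rw [← ENNReal.ofReal_one]
          apply ENNReal.ofReal_le_ofReal
          have : f 0 = φ x := by simp [hf]
          rw [norm_neg, this]
          exact hx.trans (Real.le_norm_self _)
      _ ≤ ∫⁻ t in Ioi (0 : ℝ), ‖deriv f t‖ₑ := enorm_integral_le_lintegral_enorm _
      _ ≤ ∫⁻ t in Ioi (0 : ℝ), (ENNReal.ofReal (1 / 2) *
            ENNReal.ofReal (‖fderiv ℝ φ (x - t • ω)‖ ^ 2 * (mden r t)⁻¹)
            + ENNReal.ofReal (1 / 2) * ENNReal.ofReal (mden r t)) := by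
          refine setLIntegral_mono' measurableSet_Ioi fun t ht => ?_
          have hm := mden_pos hr ht
          rw [← ofReal_norm, ← ENNReal.ofReal_mul (by norm_num), ← ENNReal.ofReal_mul (by norm_num),
            ← ENNReal.ofReal_add (by positivity) (by positivity)]
          apply ENNReal.ofReal_le_ofReal
          refine (hder t).trans ?_
          generalize ‖fderiv ℝ φ (x - t • ω)‖ = g
          have : g * (mden r t)⁻¹ * mden r t = g := by field_simp
          have h3 : 1 / 2 * (g ^ 2 * (mden r t)⁻¹) + 1 / 2 * mden r t - g
            = 1 / 2 * (mden r t)⁻¹ * (g - mden r t) ^ 2 := by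
            field_simp; ring
          have h4 : 0 ≤ 1 / 2 * (mden r t)⁻¹ * (g - mden r t) ^ 2 := by positivity
          linarith
      _ = _ := by
          have hm2 := measurable_mden r
          rw [lintegral_add_left (by fun_prop), lintegral_const_mul _ (by fun_prop),
            lintegral_const_mul _ (by fun_prop), lintegral_mden hr]
  by_contra hlt
  push Not at hlt
  have hAt : A ≠ ⊤ := (hlt.trans ENNReal.one_lt_top).ne
  rw [← ENNReal.ofReal_toReal hAt] at h1 hlt
  rw [mul_one, ← ENNReal.ofReal_mul (by norm_num),
    ← ENNReal.ofReal_add (by positivity) (by positivity), ← ENNReal.ofReal_one,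
    ENNReal.ofReal_le_ofReal_iff (by positivity)] at h1
  rw [← ENNReal.ofReal_one, ENNReal.ofReal_lt_ofReal_iff one_pos] at hlt
  linarith

/-- The pointwise potential estimate. -/
lemma potential_estimate (n : ℕ) (hn : 3 ≤ n) (φ : En n → ℝ) (hφ : ContDiff ℝ (⊤ : ℕ∞) φ)
    (hc : HasCompactSupport φ) (x : En n) (hx : 1 ≤ φ x) {r : ℝ} (hr : 0 < r) :
    (volume : Measure (En n)).toSphere univ ≤
      ∫⁻ y, ENNReal.ofReal (‖fderiv ℝ φ y‖ ^ 2) * ENNReal.ofReal (wker n r ‖x - y‖) := by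
  have hd1 : ContDiff ℝ 1 φ := hφ.of_le (by exact_mod_cast le_top)
  have hcd := (hd1.continuous_fderiv one_ne_zero)
  have hw := measurable_wker n r
  have hmeas : Measurable (fun y : En n => ENNReal.ofReal (‖fderiv ℝ φ (x - y)‖ ^ 2) *
      ENNReal.ofReal (wker n r ‖y‖)) := by
    have h1 : Measurable (fun y : En n => ‖fderiv ℝ φ (x - y)‖ ^ 2) :=
      Continuous.measurable (by fun_prop)
    fun_prop
  have h0 : ∫⁻ y, ENNReal.ofReal (‖fderiv ℝ φ y‖ ^ 2) * ENNReal.ofReal (wker n r ‖x - y‖)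
      = ∫⁻ y, ENNReal.ofReal (‖fderiv ℝ φ (x - y)‖ ^ 2) * ENNReal.ofReal (wker n r ‖y‖) := by
    rw [← lintegral_sub_left_eq_self _ x]
    simp
  rw [h0, lintegral_polar n (by omega) _ hmeas]
  calc (volume : Measure (En n)).toSphere univ
      = ∫⁻ ω, 1 ∂((volume : Measure (En n)).toSphere) := by simp
    _ ≤ _ := by
      refine lintegral_mono fun ω => ?_
      have hω : ‖(ω : En n)‖ = 1 := by simp
      refine (ray_estimate n φ hφ hc x ω hω hx hr).trans ?_
      refine setLIntegral_mono' measurableSet_Ioi fun t ht => ?_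
      have ht : 0 < t := ht
      rw [← ENNReal.ofReal_mul (by positivity), ← ENNReal.ofReal_mul (by positivity),
        norm_smul, hω, mul_one, Real.norm_of_nonneg ht.le, ← wker_mul (n := n) hr ht]
      apply ENNReal.ofReal_le_ofReal
      apply le_of_eq
      ring

lemma wker_far {n : ℕ} (hn : 3 ≤ n) {r s : ℝ} (hr : 0 < r) (hs : r ≤ s) :
    wker n r s ≤ 2 * Real.pi * r / r ^ (n - 1) := by
  obtain ⟨k, rfl⟩ : ∃ k, n = k + 3 := ⟨n - 3, by omega⟩
  have e : k + 3 - 1 = k + 2 := rfl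
  unfold wker
  rw [e]
  have hs0 : 0 < s := hr.trans_le hs
  obtain ⟨a, ha, rfl⟩ : ∃ a, 0 < a ∧ s = a ^ 2 := ⟨√s, Real.sqrt_pos.2 hs0, (Real.sq_sqrt hs0.le).symm⟩
  obtain ⟨b, hb, rfl⟩ : ∃ b, 0 < b ∧ r = b ^ 2 := ⟨√r, Real.sqrt_pos.2 hr, (Real.sq_sqrt hr.le).symm⟩
  rw [Real.sqrt_sq ha.le, Real.sqrt_sq hb.le]
  have hab : b ≤ a := by
    by_contra h
    push Not at h
    nlinarith
  have hpi := Real.pi_pos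
  calc Real.pi * a * (b ^ 2 + a ^ 2) / (b * (a ^ 2) ^ (k + 2))
      ≤ Real.pi * a * (a ^ 2 + a ^ 2) / (b * (a ^ 2) ^ (k + 2)) := by gcongr
    _ = 2 * Real.pi / (b * (a ^ (2 * k + 1))) := by
        field_simp
        ring
    _ ≤ 2 * Real.pi / (b * (b ^ (2 * k + 1))) := by gcongr
    _ = _ := by
        field_simp
        ring

lemma wker_near {n : ℕ} {r s t : ℝ} (hr : 0 < r) (ht : t ≤ r) (ht0 : 0 < t) (hs1 : t / 4 < s)
    (hs2 : s ≤ t) :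
    wker n r s ≤ 2 * Real.pi * √r * √t / (t / 4) ^ (n - 1) := by
  have hs0 : 0 < s := by linarith
  unfold wker
  have hpi := Real.pi_pos
  have hsr := Real.sqrt_pos.2 hr
  calc Real.pi * √s * (r + s) / (√r * s ^ (n - 1))
      ≤ Real.pi * √t * (r + r) / (√r * (t / 4) ^ (n - 1)) := by
        gcongr
        linarith
    _ = _ := by
        field_simp
        nlinarith [Real.sq_sqrt hr.le]

/-- Uniform bound of the potential of a measure with upper `(n-1)`-growth. -/
lemma kernel_bound (n : ℕ) (hn : 3 ≤ n) (C : ℝ) (hC : 0 < C) {r : ℝ} (hr : 0 < r)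
    (σ : Measure (En n)) (htot : σ univ ≤ ENNReal.ofReal (C * r ^ (n - 1)))
    (hball : ∀ (y : En n) (t : ℝ), 0 < t → σ (ball y t) ≤ ENNReal.ofReal (C * (2 * t) ^ (n - 1)))
    (y : En n) :
    ∫⁻ x, ENNReal.ofReal (wker n r ‖x - y‖) ∂σ ≤
      ENNReal.ofReal (C * (2 * Real.pi) * (2 * 16 ^ (n - 1) + 1) * r) := by
  have hpi := Real.pi_pos
  have hsr := Real.sqrt_pos.2 hr
  set T : ℕ → ℝ := fun j => (1 / 4) ^ j * r with hT
  have hT0 : ∀ j, 0 < T j := fun j => by positivity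
  have hTr : ∀ j, T j ≤ r := fun j => by
    have : ((1 : ℝ) / 4) ^ j ≤ 1 := pow_le_one₀ (by norm_num) (by norm_num)
    simp only [hT]; nlinarith
  have hTs : ∀ j, √(T j) = (1 / 2) ^ j * √r := fun j => by
    simp only [hT]
    rw [Real.sqrt_mul (by positivity)]
    congr 1
    rw [show ((1 : ℝ) / 4) ^ j = ((1 / 2) ^ j) ^ 2 by rw [← pow_mul, mul_comm, pow_mul]; norm_num,
      Real.sqrt_sq (by positivity)]
  set a : ℕ → ℝ := fun j => 2 * Real.pi * √r * √(T j) / (T j / 4) ^ (n - 1) with ha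
  have ha0 : ∀ j, 0 ≤ a j := fun j => by
    have := hT0 j
    simp only [ha]; positivity
  have hpt : ∀ x : En n, ENNReal.ofReal (wker n r ‖x - y‖) ≤
      (∑' j, (ball y (2 * T j)).indicator (fun _ => ENNReal.ofReal (a j)) x) +
        ENNReal.ofReal (2 * Real.pi * r / r ^ (n - 1)) := by
    intro x
    rcases le_or_gt r ‖x - y‖ with h | h
    · exact (ENNReal.ofReal_le_ofReal (wker_far hn hr h)).trans le_add_self
    · rcases (norm_nonneg (x - y)).eq_or_lt with h0 | h0
      · rw [← h0]; simp [wker]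
      · obtain ⟨j, hj1, hj2⟩ := exists_nat_pow_near_of_lt_one (x := ‖x - y‖ / r) (y := (1 : ℝ) / 4)
          (by positivity) ((div_le_one hr).2 h.le) (by norm_num) (by norm_num)
        rw [lt_div_iff₀ hr] at hj1
        rw [div_le_iff₀ hr] at hj2
        have hj1' : T j / 4 < ‖x - y‖ := by
          refine lt_of_eq_of_lt ?_ hj1
          simp only [hT]; ring
        refine le_trans ?_ le_self_add
        refine le_trans ?_ (ENNReal.le_tsum j)
        rw [indicator_of_mem]
        · exact ENNReal.ofReal_le_ofReal (wker_near hr (hTr j) (hT0 j) hj1' hj2)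
        · rw [mem_ball, dist_eq_norm]
          have := hT0 j
          have : ‖x - y‖ ≤ T j := hj2
          linarith
  calc ∫⁻ x, ENNReal.ofReal (wker n r ‖x - y‖) ∂σ
      ≤ ∫⁻ x, ((∑' j, (ball y (2 * T j)).indicator (fun _ => ENNReal.ofReal (a j)) x) +
        ENNReal.ofReal (2 * Real.pi * r / r ^ (n - 1))) ∂σ := lintegral_mono hpt
    _ = (∑' j, ENNReal.ofReal (a j) * σ (ball y (2 * T j))) +
        ENNReal.ofReal (2 * Real.pi * r / r ^ (n - 1)) * σ univ := by
        rw [lintegral_add_right _ measurable_const, lintegral_const, lintegral_tsum]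
        · congr 2
          ext j
          rw [lintegral_indicator_const measurableSet_ball]
        · intro j
          exact (measurable_const.indicator measurableSet_ball).aemeasurable
    _ ≤ (∑' j, ENNReal.ofReal (2 * Real.pi * C * 16 ^ (n - 1) * r * (1 / 2) ^ j)) +
        ENNReal.ofReal (2 * Real.pi * C * r) := by
        gcongr with j
        · refine (mul_le_mul_right (hball y _ (by have := hT0 j; positivity)) _).trans ?_
          rw [← ENNReal.ofReal_mul (ha0 j)]
          apply ENNReal.ofReal_le_ofReal
          apply le_of_eq
          simp only [ha]
          have h1 := hT0 j
          rw [hTs j]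
          have e1 : (2 * (2 * T j)) ^ (n - 1) = 16 ^ (n - 1) * (T j / 4) ^ (n - 1) := by
            rw [← mul_pow]; congr 1; ring
          rw [e1]
          have h2 : (T j / 4) ^ (n - 1) ≠ 0 := by positivity
          generalize (T j / 4) ^ (n - 1) = z at h2
          have hrr : r = √r * √r := (Real.mul_self_sqrt hr.le).symm
          generalize √r = q at hrr hsr
          subst hrr
          field_simp
        · refine (mul_le_mul_right htot _).trans ?_
          rw [← ENNReal.ofReal_mul (by positivity)]
          apply ENNReal.ofReal_le_ofReal
          apply le_of_eq
          field_simp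
    _ = _ := by
        rw [← ENNReal.ofReal_tsum_of_nonneg (fun j => by positivity)
          (summable_geometric_two.mul_left _), tsum_mul_left, tsum_geometric_two,
          ← ENNReal.ofReal_add (by positivity) (by positivity)]
        congr 1
        ring

lemma energy_bound (n : ℕ) (hn : 3 ≤ n) (C₁ C₂ : ℝ) (hC₁ : 0 < C₁) (hC₁₂ : C₁ ≤ C₂)
    (Ω : Set (En n)) (hA : AhlforsRegular n Ω C₁ C₂) (Q : En n) (hQ : Q ∈ frontier Ω)
    (r : ℝ) (hr : 0 < r) (hrd : r ≤ diam Ω) (φ : En n → ℝ) (hφ : ContDiff ℝ (⊤ : ℕ∞) φ)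
    (hc : HasCompactSupport φ) (h1 : ∀ x ∈ ball Q r ∩ frontier Ω, 1 ≤ φ x) :
    C₁ * (volume : Measure (En n)).toSphere.real univ /
      (C₂ * (2 * Real.pi) * (2 * 16 ^ (n - 1) + 1)) * r ^ (n - 2) ≤
      ∫ x, ‖fderiv ℝ φ x‖ ^ 2 := by
  have hC₂ : 0 < C₂ := hC₁.trans_le hC₁₂
  have hpi := Real.pi_pos
  set K := ball Q r ∩ frontier Ω with hK
  have hKm : MeasurableSet K := measurableSet_ball.inter isClosed_frontier.measurableSet
  set σ : Measure (En n) := (μH[(n : ℝ) - 1] : Measure (En n)).restrict K with hσ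
  have htot : σ univ ≤ ENNReal.ofReal (C₂ * r ^ (n - 1)) := by
    rw [hσ, Measure.restrict_apply_univ]
    exact (hA Q hQ r hr hrd).2
  have hfin : IsFiniteMeasure σ := ⟨htot.trans_lt ENNReal.ofReal_lt_top⟩
  have hball : ∀ (y : En n) (t : ℝ), 0 < t →
      σ (ball y t) ≤ ENNReal.ofReal (C₂ * (2 * t) ^ (n - 1)) := by
    intro y t ht
    rw [hσ, Measure.restrict_apply measurableSet_ball]
    rcases (ball y t ∩ K).eq_empty_or_nonempty with he | ⟨x, hx, hxK⟩
    · rw [he]; simp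
    rcases le_or_gt (2 * t) (diam Ω) with h | h
    · refine le_trans (measure_mono ?_) (hA x hxK.2 (2 * t) (by positivity) h).2
      rintro z ⟨hz, hzK⟩
      refine ⟨?_, hzK.2⟩
      rw [mem_ball] at *
      have := dist_triangle_right z x y
      linarith
    · refine (measure_mono inter_subset_right).trans ((hA Q hQ r hr hrd).2.trans ?_)
      apply ENNReal.ofReal_le_ofReal
      have : r ≤ 2 * t := hrd.trans h.le
      gcongr
  set S := (volume : Measure (En n)).toSphere univ with hS
  have hd1 : ContDiff ℝ 1 φ := hφ.of_le (by exact_mod_cast le_top)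
  have hcd := (hd1.continuous_fderiv one_ne_zero)
  have hint : Integrable (fun x => ‖fderiv ℝ φ x‖ ^ 2) := by
    apply Continuous.integrable_of_hasCompactSupport (by fun_prop)
    exact (hc.fderiv (𝕜 := ℝ)).comp_left (g := fun L => ‖L‖ ^ 2) (by simp)
  have hw := measurable_wker n r
  have hGm : Measurable (fun y : En n => ENNReal.ofReal (‖fderiv ℝ φ y‖ ^ 2)) :=
    (Continuous.measurable (by fun_prop : Continuous fun y : En n => ‖fderiv ℝ φ y‖ ^ 2)).ennreal_ofReal
  set M := C₂ * (2 * Real.pi) * (2 * 16 ^ (n - 1) + 1) with hM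
  have hM0 : 0 < M := by positivity
  have key : S * ENNReal.ofReal (C₁ * r ^ (n - 1)) ≤
      ENNReal.ofReal (∫ x, ‖fderiv ℝ φ x‖ ^ 2) * ENNReal.ofReal (M * r) := by
    calc S * ENNReal.ofReal (C₁ * r ^ (n - 1))
        ≤ S * μH[(n : ℝ) - 1] K := by gcongr; exact (hA Q hQ r hr hrd).1
      _ = ∫⁻ x in K, S ∂μH[(n : ℝ) - 1] := by rw [setLIntegral_const]
      _ ≤ ∫⁻ x in K, (∫⁻ y, ENNReal.ofReal (‖fderiv ℝ φ y‖ ^ 2) *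
            ENNReal.ofReal (wker n r ‖x - y‖)) ∂μH[(n : ℝ) - 1] :=
          setLIntegral_mono' hKm fun x hx => potential_estimate n hn φ hφ hc x (h1 x hx) hr
      _ = ∫⁻ y, (∫⁻ x, ENNReal.ofReal (‖fderiv ℝ φ y‖ ^ 2) *
            ENNReal.ofReal (wker n r ‖x - y‖) ∂σ) := by
          rw [lintegral_lintegral_swap]
          apply Measurable.aemeasurable
          have m1 : Measurable (fun p : En n × En n => ENNReal.ofReal (‖fderiv ℝ φ p.2‖ ^ 2)) :=
            hGm.comp measurable_snd
          have m2 : Measurable (fun p : En n × En n => ENNReal.ofReal (wker n r ‖p.1 - p.2‖)) := by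
            fun_prop
          exact m1.mul m2
      _ ≤ ∫⁻ y, ENNReal.ofReal (‖fderiv ℝ φ y‖ ^ 2) * ENNReal.ofReal (M * r) := by
          refine lintegral_mono fun y => ?_
          rw [lintegral_const_mul _ (by fun_prop)]
          gcongr
          exact kernel_bound n hn C₂ hC₂ hr σ htot hball y
      _ = _ := by
          rw [lintegral_mul_const _ hGm, ofReal_integral_eq_lintegral_ofReal hint
            (Eventually.of_forall fun x => by positivity)]
  have hSt : S ≠ ⊤ := measure_ne_top _ _
  rw [← ENNReal.ofReal_toReal hSt, ← ENNReal.ofReal_mul ENNReal.toReal_nonneg,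
    ← ENNReal.ofReal_mul (integral_nonneg fun x => by positivity),
    ENNReal.ofReal_le_ofReal_iff (mul_nonneg (integral_nonneg fun x => by positivity)
      (by positivity))] at key
  have e : n - 1 = n - 2 + 1 := by omega
  have hpow : r ^ (n - 1) = r ^ (n - 2) * r := by rw [e, pow_succ]
  rw [hpow] at key
  rw [measureReal_def, ← hS, div_mul_eq_mul_div, div_le_iff₀ hM0]
  refine le_of_mul_le_mul_right ?_ hr
  linarith

lemma capacity_bound (n : ℕ) (K K' : Set (En n)) (hKK : K ⊆ K') (hK' : IsBounded K') (c : ℝ)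
    (h : ∀ φ : En n → ℝ, ContDiff ℝ (⊤ : ℕ∞) φ → HasCompactSupport φ → (∀ x ∈ K, 1 ≤ φ x) →
      c ≤ ∫ x, ‖fderiv ℝ φ x‖ ^ 2) : c ≤ capacity n K' := by
  apply le_csInf
  · obtain ⟨R, hR0, hR⟩ := hK'.subset_ball_lt 0 (0 : En n)
    let f : ContDiffBump (0 : En n) := ⟨R, R + 1, hR0, by linarith⟩
    refine ⟨_, f, f.contDiff, f.hasCompactSupport, ?_, rfl⟩
    rw [subset_interior_iff]
    refine ⟨ball 0 R, isOpen_ball, hR, fun x hx => ?_⟩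
    exact (f.one_of_mem_closedBall (ball_subset_closedBall hx)).ge
  · rintro e ⟨φ, h1, h2, h3, rfl⟩
    refine h φ h1 h2 fun x hx => ?_
    have h4 : x ∈ {x | 1 ≤ φ x} := interior_subset (h3 (hKK hx))
    exact h4

/-- if `n ≥ 3` and `Ω ⊆ ℝⁿ` is bounded open with Ahlfors regular boundary,
then `Ω` satisfies the capacity density condition, with constant depending only on
`n, C₁, C₂`: for all `Q ∈ ∂Ω` and `0 < r ≤ diam Ω`,
`cap(B(Q,r) ∩ ∂Ω) ≥ c r^(n-2)` and `cap(B(Q,r) ∩ Ωᶜ) ≥ c r^(n-2)`. -/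
theorem stmt0 (n : ℕ) (hn : 3 ≤ n) (C₁ C₂ : ℝ) (hC₁ : 0 < C₁) (hC₁₂ : C₁ ≤ C₂) :
    ∃ c : ℝ, 0 < c ∧
      ∀ Ω : Set (En n), IsOpen Ω → IsBounded Ω → AhlforsRegular n Ω C₁ C₂ →
        ∀ Q ∈ frontier Ω, ∀ r : ℝ, 0 < r → r ≤ diam Ω →
          c * r ^ (n - 2) ≤ capacity n (ball Q r ∩ frontier Ω) ∧
            c * r ^ (n - 2) ≤ capacity n (ball Q r ∩ Ωᶜ) := by
  have hne : Nonempty (Fin n) := ⟨⟨0, by omega⟩⟩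
  have hC₂ : 0 < C₂ := hC₁.trans_le hC₁₂
  have hpi := Real.pi_pos
  have hS : 0 < (volume : Measure (En n)).toSphere.real univ := by
    rw [measureReal_def]
    refine ENNReal.toReal_pos ?_ (measure_ne_top _ _)
    rw [Ne, Measure.measure_univ_eq_zero]
    exact Measure.toSphere_ne_zero _
  refine ⟨C₁ * (volume : Measure (En n)).toSphere.real univ /
      (C₂ * (2 * Real.pi) * (2 * 16 ^ (n - 1) + 1)), by positivity, ?_⟩
  intro Ω hΩ _ hA Q hQ r hr hrd
  have hfr : frontier Ω ⊆ Ωᶜ := by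
    intro x hx hxΩ
    rw [hΩ.frontier_eq] at hx
    exact hx.2 hxΩ
  exact ⟨capacity_bound n _ _ subset_rfl (isBounded_ball.subset inter_subset_left) _
      fun φ h1 h2 h3 => energy_bound n hn C₁ C₂ hC₁ hC₁₂ Ω hA Q hQ r hr hrd φ h1 h2 h3,
    capacity_bound n _ _ (inter_subset_inter_right _ hfr)
      (isBounded_ball.subset inter_subset_left) _
      fun φ h1 h2 h3 => energy_bound n hn C₁ C₂ hC₁ hC₁₂ Ω hA Q hQ r hr hrd φ h1 h2 h3⟩
end
end

section
/- Let n ≥ 3 and let Ω ⊂ ℝⁿ be a bounded open set whose boundary ∂Ω is Ahlfors regular with constants C₁, C₂, and let a > −1. Then there exists C > 0, depending only on n, a, C₁, C₂, such that for every Q₀ ∈ ∂Ω and every 0 < r ≤ diam Ω, ∫_{B(Q₀,2r) ∩ Ω} δ(X)^a dX ≤ C r^{n+a}, where the integral is with respect to n-dimensional Lebesgue measure. -/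
open MeasureTheory Metric Set Filter Bornology
open scoped ENNReal NNReal Topology

noncomputable section

theorem kernel_bound_s2 (n : ℕ) (hn : 3 ≤ n) (b : ℝ) (hb : -(n : ℝ) < b) :
    ∃ I : ℝ, 0 ≤ I ∧ ∀ r : ℝ, 0 < r → ∀ Q : En n,
      ∫⁻ X in ball Q (7 * r), ENNReal.ofReal (dist X Q ^ b) ≤
        ENNReal.ofReal (I * r ^ ((n : ℝ) + b)) := by
  have hintg : ∀ R : ℝ, 0 < R → IntegrableOn (fun x : En n => ‖x‖ ^ b) (ball 0 R) := by
    intro R hR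
    have : Nontrivial (En n) :=
      Module.nontrivial_of_finrank_pos (R := ℝ) (by rw [finrank_euclideanSpace, Fintype.card_fin]; omega)
    rw [integrableOn_fun_norm_addHaar volume (f := fun t => t ^ b)]
    have h := (intervalIntegral.integrableOn_Ioo_rpow_iff (s := (n : ℝ) - 1 + b) hR).2 (by linarith)
    refine h.congr_fun ?_ measurableSet_Ioo
    intro y hy
    simp only [finrank_euclideanSpace, Fintype.card_fin, smul_eq_mul]
    rw [Real.rpow_add hy.1, ← Real.rpow_natCast, Nat.cast_sub (by omega), Nat.cast_one]
  refine ⟨∫ x in ball (0 : En n) 7, ‖x‖ ^ b, ?_, ?_⟩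
  · exact integral_nonneg fun x => by positivity
  intro r hr Q
  have h1 : ∫⁻ X in ball Q (7 * r), ENNReal.ofReal (dist X Q ^ b) =
      ∫⁻ X in ball (0 : En n) (7 * r), ENNReal.ofReal (‖X‖ ^ b) := by
    rw [← lintegral_indicator measurableSet_ball, ← lintegral_indicator measurableSet_ball,
      ← lintegral_sub_right_eq_self ((ball (0 : En n) (7 * r)).indicator _) Q]
    congr 1
    ext X
    simp only [indicator, mem_ball, dist_eq_norm, sub_zero]
  rw [h1, ← ofReal_integral_eq_lintegral_ofReal (hintg _ (by positivity))
    (ae_of_all _ fun x => by positivity)]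
  apply ENNReal.ofReal_le_ofReal
  have h2 := Measure.setIntegral_comp_smul_of_pos (volume : Measure (En n))
    (fun x => ‖x‖ ^ b) (ball 0 7) hr
  rw [_root_.smul_ball hr.ne'] at h2
  simp only [smul_zero, norm_smul, Real.norm_of_nonneg hr.le, finrank_euclideanSpace,
    Fintype.card_fin, smul_eq_mul] at h2
  have h3 : ∫ x in ball (0 : En n) 7, (r * ‖x‖) ^ b = r ^ b * ∫ x in ball (0 : En n) 7, ‖x‖ ^ b := by
    rw [← integral_const_mul]
    congr 1
    ext x
    rw [Real.mul_rpow hr.le (norm_nonneg _)]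
  rw [h3] at h2
  rw [mul_comm 7 r, Real.rpow_add hr, Real.rpow_natCast]
  have : r ^ n ≠ 0 := by positivity
  field_simp at h2
  linarith

theorem surface_bound (n : ℕ) :
    ∃ K : ℕ, ∀ (C₁ C₂ : ℝ) (Ω : Set (En n)), 0 ≤ C₂ → AhlforsRegular n Ω C₁ C₂ →
      ∀ Q₀ : En n, ∀ r : ℝ, 0 < r → r ≤ diam Ω →
        μH[(n : ℝ) - 1] (ball Q₀ (5 * r) ∩ frontier Ω) ≤
          ENNReal.ofReal (K * (C₂ * r ^ (n - 1))) := by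
  obtain ⟨t, -, htf, ht⟩ := (isCompact_closedBall (0 : En n) 5).finite_cover_balls
    (e := 1 / 2) (by norm_num)
  lift t to Finset (En n) using htf
  refine ⟨t.card, fun C₁ C₂ Ω hC₂ hA Q₀ r hr hrd => ?_⟩
  have hsub : ball Q₀ (5 * r) ∩ frontier Ω ⊆
      ⋃ x ∈ t, (ball (Q₀ + r • x) (r / 2) ∩ frontier Ω) := by
    rintro X ⟨hX, hXf⟩
    have hm : r⁻¹ • (X - Q₀) ∈ closedBall (0 : En n) 5 := by
      rw [mem_ball, dist_eq_norm] at hX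
      rw [mem_closedBall_zero_iff, norm_smul, norm_inv, Real.norm_of_nonneg hr.le,
        inv_mul_le_iff₀ hr]
      linarith
    have := ht hm
    simp only [mem_iUnion, Finset.mem_coe] at this
    obtain ⟨x, hx, hxb⟩ := this
    simp only [mem_iUnion]
    refine ⟨x, hx, ?_, hXf⟩
    rw [mem_ball, dist_eq_norm] at hxb ⊢
    have : X - (Q₀ + r • x) = r • (r⁻¹ • (X - Q₀) - x) := by
      rw [smul_sub, smul_inv_smul₀ hr.ne']; abel
    rw [this, norm_smul, Real.norm_of_nonneg hr.le]
    nlinarith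
  refine (measure_mono hsub).trans ((measure_biUnion_finset_le _ _).trans ?_)
  have : ∀ x ∈ t, μH[(n : ℝ) - 1] (ball (Q₀ + r • x) (r / 2) ∩ frontier Ω) ≤
      ENNReal.ofReal (C₂ * r ^ (n - 1)) := by
    intro x _
    rcases (ball (Q₀ + r • x) (r / 2) ∩ frontier Ω).eq_empty_or_nonempty with h | ⟨Q, hQ, hQf⟩
    · rw [h]; simp
    · refine (measure_mono ?_).trans (hA Q hQf r hr hrd).2
      refine inter_subset_inter_left _ (ball_subset_ball' ?_)
      rw [mem_ball, dist_comm] at hQ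
      linarith
  refine (Finset.sum_le_sum this).trans ?_
  rw [Finset.sum_const, nsmul_eq_mul, ENNReal.ofReal_mul (Nat.cast_nonneg _),
    ENNReal.ofReal_natCast]

/-- for `Ω` bounded open with Ahlfors regular boundary and `a > -1`,
there is `C = C(n, a, C₁, C₂) > 0` such that for every `Q₀ ∈ ∂Ω` and `0 < r ≤ diam Ω`,
`∫_{B(Q₀,2r) ∩ Ω} δ(X)^a dX ≤ C r^(n+a)` (Lebesgue measure, `δ(X) = dist(X,∂Ω)`). -/
theorem stmt2 (n : ℕ) (hn : 3 ≤ n) (a C₁ C₂ : ℝ) (ha : -1 < a)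
    (hC₁ : 0 < C₁) (hC₁₂ : C₁ ≤ C₂) :
    ∃ C : ℝ, 0 < C ∧
      ∀ Ω : Set (En n), IsOpen Ω → IsBounded Ω → AhlforsRegular n Ω C₁ C₂ →
        ∀ Q₀ ∈ frontier Ω, ∀ r : ℝ, 0 < r → r ≤ diam Ω →
          ∫ X in ball Q₀ (2 * r) ∩ Ω, infDist X (frontier Ω) ^ a ≤
            C * r ^ ((n : ℝ) + a) := by
  have hC₂ : 0 < C₂ := hC₁.trans_le hC₁₂
  set b : ℝ := a - (n - 1) with hb
  obtain ⟨I, hI, hker⟩ := kernel_bound_s2 n hn b (by rw [hb]; linarith)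
  obtain ⟨K, hK⟩ := surface_bound n
  have hmb : ∀ d e : ℝ, 0 < d → d / 2 ≤ e → e ≤ 3 / 2 * d →
      (min ((1 / 2) ^ b) ((3 / 2) ^ b)) * d ^ b ≤ e ^ b := by
    intro d e hd h1 h2
    rcases le_total 0 b with h | h
    · calc _ ≤ (1 / 2) ^ b * d ^ b := by gcongr; exact min_le_left _ _
        _ = (1 / 2 * d) ^ b := by rw [Real.mul_rpow (by norm_num) hd.le]
        _ ≤ e ^ b := Real.rpow_le_rpow (by positivity) (by linarith) h
    · calc _ ≤ (3 / 2) ^ b * d ^ b := by gcongr; exact min_le_right _ _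
        _ = (3 / 2 * d) ^ b := by rw [Real.mul_rpow (by norm_num) hd.le]
        _ ≤ e ^ b := Real.rpow_le_rpow_of_nonpos (by linarith) h2 h
  set m' : ℝ := min ((1 / 2) ^ b) ((3 / 2) ^ b) with hm'
  have hm0 : 0 < m' := lt_min (by positivity) (by positivity)
  clear_value m'
  set L : ℝ := 2 ^ (n - 1) / (m' * C₁) with hL
  have hL0 : 0 < L := by positivity
  refine ⟨L * I * (K * C₂) + 1, by positivity, ?_⟩
  intro Ω hΩ _ hA Q₀ hQ₀ r hr hrd
  have hσ := hK C₁ C₂ Ω hC₂.le hA Q₀ r hr hrd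
  set σ : Measure (En n) := μH[(n : ℝ) - 1].restrict (ball Q₀ (5 * r) ∩ frontier Ω) with hσdef
  have hms : MeasurableSet (ball Q₀ (5 * r) ∩ frontier Ω) :=
    measurableSet_ball.inter isClosed_frontier.measurableSet
  have hσu : σ univ ≤ ENNReal.ofReal (K * (C₂ * r ^ (n - 1))) := by
    rw [hσdef, Measure.restrict_apply_univ]; exact hσ
  have : IsFiniteMeasure σ := ⟨hσu.trans_lt ENNReal.ofReal_lt_top⟩
  -- pointwise bound
  have hpt : ∀ X ∈ ball Q₀ (2 * r) ∩ Ω, ENNReal.ofReal (infDist X (frontier Ω) ^ a) ≤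
      ENNReal.ofReal L * ∫⁻ Q, ENNReal.ofReal (dist X Q ^ b) ∂σ := by
    rintro X ⟨hXb, hXΩ⟩
    obtain ⟨Q, hQf, hQd⟩ := isClosed_frontier.exists_infDist_eq_dist ⟨Q₀, hQ₀⟩ X
    set d := infDist X (frontier Ω) with hd
    have hd0 : 0 < d := by
      rw [hQd]
      refine dist_pos.2 ?_
      rintro rfl
      exact (hΩ.inter_frontier_eq ▸ (⟨hXΩ, hQf⟩ : X ∈ Ω ∩ frontier Ω) : X ∈ (∅ : Set (En n)))
    have hd2 : d < 2 * r := (infDist_le_dist_of_mem hQ₀).trans_lt hXb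
    have hlow := (hA Q hQf (d / 2) (by positivity) (by linarith)).1
    have hsub : ball Q (d / 2) ∩ frontier Ω ⊆ ball Q (d / 2) ∩ (ball Q₀ (5 * r) ∩ frontier Ω) := by
      rintro P ⟨hP, hPf⟩
      refine ⟨hP, ?_, hPf⟩
      rw [mem_ball] at *
      have h1 := dist_triangle P Q Q₀
      have h2 := dist_triangle Q X Q₀
      rw [dist_comm Q X] at h2
      linarith
    have hσb : ENNReal.ofReal (C₁ * (d / 2) ^ (n - 1)) ≤ σ (ball Q (d / 2)) := by
      rw [hσdef, Measure.restrict_apply measurableSet_ball]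
      exact hlow.trans (measure_mono hsub)
    have hintg : ENNReal.ofReal (m' * d ^ b) * σ (ball Q (d / 2)) ≤
        ∫⁻ Q, ENNReal.ofReal (dist X Q ^ b) ∂σ := by
      rw [← setLIntegral_const]
      refine (setLIntegral_mono' measurableSet_ball ?_).trans (setLIntegral_le_lintegral _ _)
      intro P hP
      apply ENNReal.ofReal_le_ofReal
      rw [mem_ball] at hP
      have h1 := dist_triangle X P Q
      have h2 := dist_triangle X Q P
      rw [dist_comm Q P] at h2
      exact hmb d _ hd0 (by linarith) (by linarith)
    calc ENNReal.ofReal (d ^ a)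
        = ENNReal.ofReal L * (ENNReal.ofReal (m' * d ^ b) *
            ENNReal.ofReal (C₁ * (d / 2) ^ (n - 1))) := by
          rw [← ENNReal.ofReal_mul (by positivity), ← ENNReal.ofReal_mul (by positivity)]
          congr 1
          have : d ^ a = d ^ b * d ^ (n - 1) := by
            rw [← Real.rpow_natCast d (n - 1), ← Real.rpow_add hd0, Nat.cast_sub (by omega), hb]
            congr 1; push_cast; ring
          rw [this, hL, div_pow]
          field_simp
      _ ≤ _ := by gcongr; exact (mul_le_mul_right hσb _).trans hintg
  have hmeas : Measurable (fun p : En n × En n => ENNReal.ofReal (dist p.1 p.2 ^ b)) := by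
    fun_prop
  have hmain : ∫⁻ X in ball Q₀ (2 * r) ∩ Ω, ENNReal.ofReal (infDist X (frontier Ω) ^ a) ≤
      ENNReal.ofReal ((L * I * (K * C₂)) * r ^ ((n : ℝ) + a)) := by
    calc _ ≤ ∫⁻ X in ball Q₀ (2 * r) ∩ Ω,
            ENNReal.ofReal L * ∫⁻ Q, ENNReal.ofReal (dist X Q ^ b) ∂σ :=
          setLIntegral_mono' (measurableSet_ball.inter hΩ.measurableSet) hpt
      _ ≤ ∫⁻ X in ball Q₀ (2 * r),
            ENNReal.ofReal L * ∫⁻ Q, ENNReal.ofReal (dist X Q ^ b) ∂σ :=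
          lintegral_mono_set inter_subset_left
      _ = ENNReal.ofReal L * ∫⁻ Q, (∫⁻ X in ball Q₀ (2 * r),
            ENNReal.ofReal (dist X Q ^ b)) ∂σ := by
          rw [lintegral_const_mul' _ _ ENNReal.ofReal_ne_top,
            lintegral_lintegral_swap hmeas.aemeasurable]
      _ ≤ ENNReal.ofReal L * ∫⁻ Q, ENNReal.ofReal (I * r ^ ((n : ℝ) + b)) ∂σ := by
          gcongr ENNReal.ofReal L * ?_
          rw [hσdef]
          refine setLIntegral_mono' hms ?_
          rintro Q ⟨hQ, -⟩
          refine (lintegral_mono_set (ball_subset_ball' ?_)).trans (hker r hr Q)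
          rw [mem_ball, dist_comm] at hQ
          linarith
      _ ≤ ENNReal.ofReal L * (ENNReal.ofReal (I * r ^ ((n : ℝ) + b)) *
            ENNReal.ofReal (K * (C₂ * r ^ (n - 1)))) := by
          rw [lintegral_const]; gcongr
      _ = _ := by
          rw [← ENNReal.ofReal_mul (by positivity), ← ENNReal.ofReal_mul (by positivity)]
          congr 1
          -- exponent algebra
          have h1 : r ^ ((n : ℝ) + b) = r ^ (a + 1) := by congr 1; rw [hb]; ring
          have h2 : r ^ ((n : ℝ) + a) = r ^ (a + 1) * r ^ (n - 1) := by
            rw [← Real.rpow_natCast r (n - 1), ← Real.rpow_add hr, Nat.cast_sub (by omega)]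
            congr 1; push_cast; ring
          rw [h1, h2]; ring
  rw [integral_eq_lintegral_of_nonneg_ae
    (ae_of_all _ fun X => Real.rpow_nonneg infDist_nonneg _)
    (by
      have : Measurable fun X : En n => infDist X (frontier Ω) ^ a :=
        (continuous_infDist_pt _).measurable.pow_const a
      exact this.aestronglyMeasurable)]
  refine (ENNReal.toReal_le_of_le_ofReal (by positivity) hmain).trans ?_
  have : 0 < r ^ ((n : ℝ) + a) := by positivity
  nlinarith
end
end

section
/- Let n ≥ 3 and let Ω ⊂ ℝⁿ be a bounded open set whose boundary ∂Ω is Ahlfors regular with constants C₁, C₂. Then there exists C > 0, depending only on n, C₁, C₂, such that for every Q₀ ∈ ∂Ω, every 0 < r ≤ diam Ω and every 0 < s ≤ 2r, the Lebesgue measure of the collar {X ∈ B(Q₀,2r) ∩ Ω : dist(X,∂Ω) < s} is at most C s r^{n−1}. -/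
open MeasureTheory Metric Set Filter Bornology
open scoped ENNReal NNReal Topology

noncomputable section

theorem aux_cover (n : ℕ) : ∃ N : ℕ, ∀ (Ω : Set (En n)) (C₁ C₂ : ℝ), 0 ≤ C₂ →
    AhlforsRegular n Ω C₁ C₂ → ∀ Q₀ : En n, ∀ r : ℝ, 0 < r → r ≤ diam Ω →
      μH[(n : ℝ) - 1] (ball Q₀ (5 * r) ∩ frontier Ω) ≤
        ENNReal.ofReal (N * (C₂ * r ^ (n - 1))) := by
  obtain ⟨T, -, hTf, hT⟩ := finite_cover_balls_of_compact
    (isCompact_closedBall (0 : En n) 5) (e := 1 / 2) (by norm_num)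
  lift T to Finset (En n) using hTf
  refine ⟨T.card, fun Ω C₁ C₂ hC₂ hA Q₀ r hr hrd => ?_⟩
  have hsub : ball Q₀ (5 * r) ∩ frontier Ω ⊆
      ⋃ y ∈ T, (ball (Q₀ + r • y) (r / 2) ∩ frontier Ω) := by
    rintro x ⟨hx, hxF⟩
    have hx' : r⁻¹ • (x - Q₀) ∈ closedBall (0 : En n) 5 := by
      rw [mem_closedBall_zero_iff, norm_smul, norm_inv, Real.norm_of_nonneg hr.le]
      rw [mem_ball_iff_norm] at hx
      rw [inv_mul_le_iff₀ hr]; linarith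
    obtain ⟨y, hy, hxy⟩ := mem_iUnion₂.1 (hT hx')
    refine mem_iUnion₂.2 ⟨y, hy, ?_, hxF⟩
    rw [mem_ball_iff_norm] at hxy ⊢
    have : x - (Q₀ + r • y) = r • (r⁻¹ • (x - Q₀) - y) := by
      rw [smul_sub, smul_inv_smul₀ hr.ne']; abel
    rw [this, norm_smul, Real.norm_of_nonneg hr.le]
    nlinarith
  refine (measure_mono hsub).trans ((measure_biUnion_finset_le _ _).trans ?_)
  have hone : ∀ y ∈ T, μH[(n : ℝ) - 1] (ball (Q₀ + r • y) (r / 2) ∩ frontier Ω) ≤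
      ENNReal.ofReal (C₂ * r ^ (n - 1)) := by
    intro y _
    rcases (ball (Q₀ + r • y) (r / 2) ∩ frontier Ω).eq_empty_or_nonempty with h | ⟨q, hq, hqF⟩
    · rw [h]; simp
    · refine (measure_mono ?_).trans (hA q hqF r hr hrd).2
      refine inter_subset_inter_left _ fun z hz => ?_
      rw [mem_ball] at *
      linarith [dist_triangle_right z q (Q₀ + r • y)]
  refine (Finset.sum_le_sum hone).trans ?_
  rw [Finset.sum_const, nsmul_eq_mul, ENNReal.ofReal_mul (Nat.cast_nonneg _),
    ENNReal.ofReal_natCast]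

/-- for `Ω` bounded open with Ahlfors regular boundary there is
`C = C(n, C₁, C₂) > 0` such that for every `Q₀ ∈ ∂Ω`, `0 < r ≤ diam Ω` and `0 < s ≤ 2r`,
the Lebesgue measure of the collar `{X ∈ B(Q₀,2r) ∩ Ω : dist(X,∂Ω) < s}` is
at most `C s r^(n-1)`. -/
theorem stmt3 (n : ℕ) (hn : 3 ≤ n) (C₁ C₂ : ℝ) (hC₁ : 0 < C₁) (hC₁₂ : C₁ ≤ C₂) :
    ∃ C : ℝ, 0 < C ∧
      ∀ Ω : Set (En n), IsOpen Ω → IsBounded Ω → AhlforsRegular n Ω C₁ C₂ →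
        ∀ Q₀ ∈ frontier Ω, ∀ r : ℝ, 0 < r → r ≤ diam Ω → ∀ s : ℝ, 0 < s → s ≤ 2 * r →
          volume {X ∈ ball Q₀ (2 * r) ∩ Ω | infDist X (frontier Ω) < s} ≤
            ENNReal.ofReal (C * s * r ^ (n - 1)) := by
  obtain ⟨N, hN⟩ := aux_cover n
  have hC₂ : 0 < C₂ := hC₁.trans_le hC₁₂
  set v : ℝ := (volume (ball (0 : En n) 1)).toReal with hv
  have hv0 : 0 ≤ v := ENNReal.toReal_nonneg
  refine ⟨7 ^ n * v * N * C₂ / (2 * C₁) + 1, by positivity, ?_⟩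
  intro Ω _ _ hA Q₀ hQ₀ r hr hrd s hs hsr
  set t := s / 2 with ht
  have ht0 : 0 < t := by positivity
  obtain ⟨u, huF, hudisj, hucov⟩ := Vitali.exists_disjoint_subfamily_covering_enlargement_closedBall
    (ball Q₀ (4 * r) ∩ frontier Ω) (fun x : En n => x) (fun _ => t) t (fun _ _ => le_rfl) 5
      (by norm_num)
  have hdb : u.PairwiseDisjoint (fun x => ball x t) := fun a ha b hb hab =>
    (hudisj ha hb hab).mono ball_subset_closedBall ball_subset_closedBall
  have hcount : u.Countable := hdb.countable_of_isOpen (fun _ _ => isOpen_ball)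
    (fun _ _ => nonempty_ball.2 ht0)
  have hcov : {X ∈ ball Q₀ (2 * r) ∩ Ω | infDist X (frontier Ω) < s} ⊆
      ⋃ x ∈ u, ball x (7 * t) := by
    rintro X ⟨⟨hX, -⟩, hXs⟩
    obtain ⟨q, hq, hXq⟩ := (infDist_lt_iff ⟨Q₀, hQ₀⟩).1 hXs
    have hq4 : q ∈ ball Q₀ (4 * r) := by
      rw [mem_ball] at *
      linarith [dist_triangle_left q Q₀ X]
    obtain ⟨b, hb, hqb⟩ := hucov q ⟨hq4, hq⟩
    have h1 := hqb (mem_closedBall_self ht0.le)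
    refine mem_iUnion₂.2 ⟨b, hb, ?_⟩
    rw [mem_closedBall] at h1
    rw [mem_ball]
    linarith [dist_triangle X q b]
  have hsum : ∑' _ : u, ENNReal.ofReal (C₁ * t ^ (n - 1)) ≤
      ENNReal.ofReal (N * (C₂ * r ^ (n - 1))) := by
    calc ∑' _ : u, ENNReal.ofReal (C₁ * t ^ (n - 1))
        ≤ ∑' x : u, μH[(n : ℝ) - 1] (ball (x : En n) t ∩ frontier Ω) :=
          ENNReal.tsum_le_tsum fun x => (hA x (huF x.2).2 t ht0 (by linarith)).1
      _ = μH[(n : ℝ) - 1] (⋃ x ∈ u, (ball (x : En n) t ∩ frontier Ω)) := by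
          rw [measure_biUnion hcount]
          · exact fun a ha b hb hab => (hdb ha hb hab).mono inter_subset_left inter_subset_left
          · exact fun _ _ => measurableSet_ball.inter isClosed_frontier.measurableSet
      _ ≤ μH[(n : ℝ) - 1] (ball Q₀ (5 * r) ∩ frontier Ω) := by
          refine measure_mono (iUnion₂_subset fun x hx => inter_subset_inter_left _ fun z hz => ?_)
          have := (huF hx).1
          rw [mem_ball] at *
          linarith [dist_triangle z x Q₀]
      _ ≤ _ := hN Ω C₁ C₂ hC₂.le hA Q₀ r hr hrd
  have hK0 : 0 ≤ 7 ^ n * t * v / C₁ := by positivity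
  have hball : ∀ x : En n, volume (ball x (7 * t)) =
      ENNReal.ofReal (7 ^ n * t * v / C₁) * ENNReal.ofReal (C₁ * t ^ (n - 1)) := by
    intro x
    rw [Measure.addHaar_ball_of_pos _ _ (by positivity), finrank_euclideanSpace_fin,
      ← ENNReal.ofReal_toReal (measure_ball_lt_top (μ := volume) (x := (0 : En n)) (r := 1)).ne,
      ← hv, ← ENNReal.ofReal_mul (by positivity), ← ENNReal.ofReal_mul hK0]
    congr 1
    have : t ^ n = t * t ^ (n - 1) := by
      rw [← pow_succ', Nat.sub_add_cancel (by omega)]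
    rw [mul_pow, this]
    field_simp
  calc _ ≤ volume (⋃ x ∈ u, ball x (7 * t)) := measure_mono hcov
    _ ≤ ∑' x : u, volume (ball (x : En n) (7 * t)) := measure_biUnion_le _ hcount _
    _ = ENNReal.ofReal (7 ^ n * t * v / C₁) * ∑' _ : u, ENNReal.ofReal (C₁ * t ^ (n - 1)) := by
        rw [← ENNReal.tsum_mul_left]
        exact tsum_congr fun x => hball x
    _ ≤ ENNReal.ofReal (7 ^ n * t * v / C₁) * ENNReal.ofReal (N * (C₂ * r ^ (n - 1))) := by
        gcongr
    _ ≤ _ := by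
        rw [← ENNReal.ofReal_mul hK0]
        apply ENNReal.ofReal_le_ofReal
        have h2 : 7 ^ n * t * v / C₁ * (N * (C₂ * r ^ (n - 1))) =
            7 ^ n * v * N * C₂ / (2 * C₁) * s * r ^ (n - 1) := by
          rw [ht]; field_simp
        rw [h2]
        gcongr
        linarith
end
end

section
/- Let n ≥ 1 and 0 < c ≤ C. Let B = B(x, ρ) and B' = B(x', ρ') be balls in ℝⁿ with B ∩ B' ≠ ∅ and c ρ' ≤ ρ ≤ C ρ', and set λ = 1 + 2/c. Then B' ⊂ λB (the concentric dilate of B), and there exists a constant A, depending only on n, c, C, such that for every u : ℝⁿ → ℝ differentiable on λB with ∫_{λB} |∇u|² dy < ∞, one has |⨍_B u dx − ⨍_{B'} u dx|² ≤ (A / |B|) ρ² ∫_{λB} |∇u(y)|² dy, where |B| is the Lebesgue measure of B and ⨍ denotes the average. -/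
open MeasureTheory Metric Set Filter Bornology
open scoped ENNReal NNReal Topology

noncomputable section

theorem aux_cs {α : Type*} [MeasurableSpace α] (P : Measure α) [IsProbabilityMeasure P]
    (F : α → ℝ≥0∞) (hF : AEMeasurable F P) :
    (∫⁻ a, F a ∂P) ^ 2 ≤ ∫⁻ a, F a ^ 2 ∂P := by
  have h := ENNReal.lintegral_mul_le_Lp_mul_Lq P (p := 2) (q := 2)
    (Real.HolderConjugate.two_two) hF (aemeasurable_const (b := (1 : ℝ≥0∞)))
  simp only [Pi.mul_apply, mul_one, ENNReal.one_rpow, lintegral_const, measure_univ] at h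
  calc (∫⁻ a, F a ∂P) ^ 2 ≤ ((∫⁻ a, F a ^ (2 : ℝ) ∂P) ^ (1 / (2 : ℝ))) ^ 2 := by gcongr
    _ = ∫⁻ a, F a ^ 2 ∂P := by
      rw [← ENNReal.rpow_natCast, ← ENNReal.rpow_mul]
      norm_num

theorem aux_path (g g' : ℝ → ℝ) (hg : ∀ t ∈ Icc (0 : ℝ) 1, HasDerivAt g (g' t) t)
    (hm : Measurable g') :
    ‖g 0 - g 1‖ₑ ^ 2 ≤ ∫⁻ t in Ioc (0 : ℝ) 1, ‖g' t‖ₑ ^ 2 := by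
  have : IsProbabilityMeasure (volume.restrict (Ioc (0 : ℝ) 1)) := ⟨by simp⟩
  have h1 := aux_cs (volume.restrict (Ioc (0 : ℝ) 1)) (fun t => ‖g' t‖ₑ) hm.enorm.aemeasurable
  refine le_trans ?_ h1
  gcongr
  by_cases htop : ∫⁻ t in Ioc (0 : ℝ) 1, ‖g' t‖ₑ = ∞
  · rw [htop]; exact le_top
  have hint : IntervalIntegrable g' volume 0 1 := by
    rw [intervalIntegrable_iff_integrableOn_Ioc_of_le zero_le_one]
    exact ⟨hm.aestronglyMeasurable, lt_top_iff_ne_top.2 htop⟩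
  have hftc := intervalIntegral.integral_eq_sub_of_hasDerivAt
    (f := g) (f' := g') (a := 0) (b := 1) (by rw [uIcc_of_le zero_le_one]; exact hg) hint
  rw [← enorm_neg, neg_sub, ← hftc, intervalIntegral.integral_of_le zero_le_one]
  exact enorm_integral_le_lintegral_enorm _

theorem aux_map {n : ℕ} (x : En n) (r : ℝ) (hr : 0 < r) :
    Measure.map (fun z : En n => x + r • z)
      ((volume (ball (0 : En n) 1))⁻¹ • volume.restrict (ball (0 : En n) 1))
      = (volume (ball x r))⁻¹ • volume.restrict (ball x r) := by
  have hmeas : Measurable (fun z : En n => x + r • z) := by fun_prop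
  have hpre : (fun z : En n => x + r • z) ⁻¹' ball x r = ball 0 1 := by
    ext z
    simp only [mem_preimage, mem_ball, dist_eq_norm, add_sub_cancel_left, sub_zero, norm_smul,
      Real.norm_eq_abs, abs_of_pos hr]
    exact mul_lt_iff_lt_one_right hr
  have hmapv : Measure.map (fun z : En n => x + r • z) volume
      = ENNReal.ofReal ((r ^ n)⁻¹) • (volume : Measure (En n)) := by
    have : (fun z : En n => x + r • z) = (fun z => x + z) ∘ (fun z => r • z) := rfl
    rw [this, ← Measure.map_map (by fun_prop) (by fun_prop),
      Measure.map_addHaar_smul volume hr.ne', Measure.map_smul, map_add_left_eq_self]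
    simp [abs_of_pos hr]
  have hv : volume (ball x r) = ENNReal.ofReal (r ^ n) * volume (ball (0 : En n) 1) := by
    rw [Measure.addHaar_ball_of_pos _ _ hr]; simp
  rw [Measure.map_smul, ← hpre, ← Measure.restrict_map hmeas measurableSet_ball, hmapv, hpre,
    Measure.restrict_smul, smul_smul, hv]
  congr 1
  rw [ENNReal.mul_inv (Or.inl (by simp; positivity)) (Or.inl (by simp)),
    ENNReal.ofReal_inv_of_pos (by positivity), mul_comm]

theorem aux_avg {n : ℕ} (x : En n) (r : ℝ) (hr : 0 < r) (u : En n → ℝ) :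
    (⨍ y in ball x r, u y) = ∫ z, u (x + r • z)
      ∂((volume (ball (0 : En n) 1))⁻¹ • volume.restrict (ball (0 : En n) 1)) := by
  have hemb : MeasurableEmbedding (fun z : En n => x + r • z) :=
    ((Homeomorph.smulOfNeZero r hr.ne').trans (Homeomorph.addLeft x)).measurableEmbedding
  rw [← hemb.integral_map (g := u), aux_map x r hr]
  simp [average]

theorem aux_integrable {n : ℕ} (x x' : En n) (r R : ℝ) (hr : 0 < r) (u : En n → ℝ)
    (h : closedBall x' r ⊆ ball x R) (hu : DifferentiableOn ℝ u (ball x R)) :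
    Integrable (fun z => u (x' + r • z))
      ((volume (ball (0 : En n) 1))⁻¹ • volume.restrict (ball (0 : En n) 1)) := by
  have hemb : MeasurableEmbedding (fun z : En n => x' + r • z) :=
    ((Homeomorph.smulOfNeZero r hr.ne').trans (Homeomorph.addLeft x')).measurableEmbedding
  have := (hemb.integrable_map_iff (g := u)
    (μ := (volume (ball (0 : En n) 1))⁻¹ • volume.restrict (ball (0 : En n) 1)))
  refine this.1 ?_
  rw [aux_map x' r hr]
  refine Integrable.smul_measure ?_ (by simp [(measure_ball_pos volume x' hr).ne'])
  exact ((hu.continuousOn.mono h).integrableOn_compact (isCompact_closedBall x' r)).mono_set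
    ball_subset_closedBall

theorem aux_main {n : ℕ} (x x' : En n) (r r' R M K : ℝ) (hr : 0 < r) (hr' : 0 < r')
    (hxx : dist x' x < r + r') (hR : r + 2 * r' ≤ R) (hM : 2 * (r + r') ≤ M)
    (hK : 1 ≤ K) (hK' : r ≤ K * r')
    (u : En n → ℝ) (hu : DifferentiableOn ℝ u (ball x R)) :
    ‖(⨍ y in ball x r, u y) - ⨍ y in ball x' r', u y‖ₑ ^ 2 ≤
      ENNReal.ofReal (M ^ 2) * (ENNReal.ofReal (K ^ n) * (volume (ball x r))⁻¹ *
        ∫⁻ y in ball x R, ‖fderiv ℝ u y‖ₑ ^ 2) := by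
  set P := (volume (ball (0 : En n) 1))⁻¹ • volume.restrict (ball (0 : En n) 1) with hP
  have hPp : IsProbabilityMeasure P := ⟨by
    simp only [hP, Measure.smul_apply, Measure.restrict_apply_univ, smul_eq_mul]
    exact ENNReal.inv_mul_cancel (measure_ball_pos volume _ one_pos).ne' measure_ball_lt_top.ne⟩
  have hball : ∀ᵐ z ∂P, z ∈ ball (0 : En n) 1 :=
    Measure.ae_smul_measure (ae_restrict_mem measurableSet_ball) _
  have hI := aux_integrable x x r R hr u (by
    intro y hy; rw [mem_closedBall] at hy; rw [mem_ball]; linarith) hu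
  have hI' := aux_integrable x x' r' R hr' u (by
    intro y hy; rw [mem_closedBall] at hy; rw [mem_ball]
    have := dist_triangle y x' x
    linarith) hu
  rw [aux_avg x r hr, aux_avg x' r' hr', ← integral_sub hI hI']
  let X : ℝ → En n := fun t => x + t • (x' - x)
  let S : ℝ → ℝ := fun t => r + t * (r' - r)
  have hS : ∀ t ∈ Icc (0 : ℝ) 1, 0 < S t ∧ r ≤ K * S t := by
    rintro t ⟨h0, h1⟩
    have e : S t = (1 - t) * r + t * r' := by simp only [S]; ring
    rw [e]
    constructor
    · rcases h0.eq_or_lt with rfl | h0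
      · simpa using hr
      · have := mul_nonneg (sub_nonneg.2 h1) hr.le
        have := mul_pos h0 hr'
        linarith
    · have a1 : (1 - t) * r ≤ (1 - t) * (K * r) :=
        mul_le_mul_of_nonneg_left (by nlinarith) (sub_nonneg.2 h1)
      have a2 : t * r ≤ t * (K * r') := mul_le_mul_of_nonneg_left hK' h0
      nlinarith
  have hsub : ∀ t ∈ Icc (0 : ℝ) 1, ball (X t) (S t) ⊆ ball x R := by
    rintro t ⟨h0, h1⟩ y hy
    rw [mem_ball] at hy ⊢
    have h2 : dist (X t) x = t * dist x' x := by
      simp [X, dist_eq_norm, norm_smul, abs_of_nonneg h0]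
    have h3 := dist_triangle y (X t) x
    have h4 : t * dist x' x ≤ t * (r + r') := mul_le_mul_of_nonneg_left hxx.le h0
    have h5 : t * r' ≤ r' := by nlinarith
    simp only [S] at hy
    nlinarith
  have hin : ∀ t ∈ Icc (0 : ℝ) 1, ∀ z ∈ ball (0 : En n) 1, X t + S t • z ∈ ball x R := by
    intro t ht z hz
    apply hsub t ht
    have := (hS t ht).1
    rw [mem_ball_zero_iff] at hz
    simp only [mem_ball, dist_eq_norm, add_sub_cancel_left, norm_smul, Real.norm_eq_abs,
      abs_of_pos this]
    nlinarith
  have hM0 : 0 ≤ M := by linarith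
  have hfd : Measurable (fun y => fderiv ℝ u y) := measurable_fderiv ℝ u
  have hXS : Measurable (fun p : En n × ℝ => X p.2 + S p.2 • p.1) := by
    simp only [X, S]; fun_prop
  have hXSt : ∀ t, Measurable (fun z : En n => X t + S t • z) := by
    intro t; fun_prop
  have hXSz : ∀ z, Measurable (fun t : ℝ => X t + S t • z) := by
    intro z; simp only [X, S]; fun_prop
  calc ‖∫ z, u (x + r • z) - u (x' + r' • z) ∂P‖ₑ ^ 2
      ≤ (∫⁻ z, ‖u (x + r • z) - u (x' + r' • z)‖ₑ ∂P) ^ 2 := by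
        gcongr; exact enorm_integral_le_lintegral_enorm _
    _ ≤ ∫⁻ z, ‖u (x + r • z) - u (x' + r' • z)‖ₑ ^ 2 ∂P :=
        aux_cs P _ (hI.sub hI').aestronglyMeasurable.enorm
    _ ≤ ∫⁻ z, (∫⁻ t in Ioc (0 : ℝ) 1,
          ENNReal.ofReal (M ^ 2) * ‖fderiv ℝ u (X t + S t • z)‖ₑ ^ 2) ∂P := by
        apply lintegral_mono_ae
        filter_upwards [hball] with z hz
        have hp := aux_path (fun t => u (X t + S t • z))
          (fun t => fderiv ℝ u (X t + S t • z) ((x' - x) + (r' - r) • z)) (by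
            intro t ht
            have hd : HasFDerivAt u (fderiv ℝ u (X t + S t • z)) (X t + S t • z) :=
              ((hu _ (hin t ht z hz)).differentiableAt
                (isOpen_ball.mem_nhds (hin t ht z hz))).hasFDerivAt
            have hX : HasDerivAt X (x' - x) t := by
              have h := ((hasDerivAt_id t).smul_const (x' - x)).const_add x
              rw [one_smul] at h
              exact h
            have hSd : HasDerivAt S (r' - r) t := by
              have h := ((hasDerivAt_id t).mul_const (r' - r)).const_add r
              rw [one_mul] at h
              exact h
            exact hd.comp_hasDerivAt t (hX.add (hSd.smul_const z)))
          ((hfd.comp (hXSz z)).apply_continuousLinearMap _)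
        have e0 : X 0 + S 0 • z = x + r • z := by simp [X, S]
        have e1 : X 1 + S 1 • z = x' + r' • z := by simp [X, S]
        simp only [e0, e1] at hp
        refine hp.trans (lintegral_mono fun t => ?_)
        have hv : ‖(x' - x) + (r' - r) • z‖ ≤ M := by
          rw [mem_ball_zero_iff] at hz
          rw [dist_eq_norm] at hxx
          have h1 := norm_add_le (x' - x) ((r' - r) • z)
          rw [norm_smul, Real.norm_eq_abs] at h1
          have h2 : |r' - r| ≤ r + r' := abs_le.2 ⟨by linarith, by linarith⟩
          have h3 : |r' - r| * ‖z‖ ≤ (r + r') * 1 := by gcongr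
          linarith
        have hle : ‖fderiv ℝ u (X t + S t • z) ((x' - x) + (r' - r) • z)‖ₑ
            ≤ ENNReal.ofReal M * ‖fderiv ℝ u (X t + S t • z)‖ₑ := by
          rw [← ofReal_norm, ← ofReal_norm, ← ENNReal.ofReal_mul hM0]
          apply ENNReal.ofReal_le_ofReal
          refine (ContinuousLinearMap.le_opNorm _ _).trans ?_
          rw [mul_comm]
          gcongr
        calc _ ≤ (ENNReal.ofReal M * ‖fderiv ℝ u (X t + S t • z)‖ₑ) ^ 2 := by gcongr
          _ = _ := by rw [mul_pow, ENNReal.ofReal_pow hM0]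
    _ = ∫⁻ t in Ioc (0 : ℝ) 1, (∫⁻ z,
          ENNReal.ofReal (M ^ 2) * ‖fderiv ℝ u (X t + S t • z)‖ₑ ^ 2 ∂P) := by
        apply lintegral_lintegral_swap
        exact (((hfd.comp hXS).enorm.pow_const 2).const_mul _).aemeasurable
    _ ≤ ∫⁻ t in Ioc (0 : ℝ) 1, (ENNReal.ofReal (M ^ 2) *
          (ENNReal.ofReal (K ^ n) * (volume (ball x r))⁻¹ *
            ∫⁻ y in ball x R, ‖fderiv ℝ u y‖ₑ ^ 2)) := by
        apply setLIntegral_mono measurable_const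
        intro t ht
        have ht' := Ioc_subset_Icc_self ht
        obtain ⟨hs, hs'⟩ := hS t ht'
        have hmt : Measurable (fun z : En n => ‖fderiv ℝ u (X t + S t • z)‖ₑ ^ 2) :=
          (hfd.comp (hXSt t)).enorm.pow_const 2
        rw [lintegral_const_mul _ hmt]
        gcongr
        have := lintegral_map (μ := P) (hfd.enorm.pow_const 2) (hXSt t)
        rw [← this, hP, aux_map (X t) (S t) hs, lintegral_smul_measure, smul_eq_mul]
        refine mul_le_mul' ?_ (lintegral_mono_set (hsub t ht'))
        have hvol : volume (ball x r) ≤ ENNReal.ofReal (K ^ n) * volume (ball (X t) (S t)) := by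
          rw [Measure.addHaar_ball_of_pos _ _ hr, Measure.addHaar_ball_of_pos _ _ hs, ← mul_assoc,
            ← ENNReal.ofReal_mul (by positivity), finrank_euclideanSpace_fin, ← mul_pow]
          gcongr
        have hv0 := (measure_ball_pos volume x hr).ne'
        have hvt : volume (ball x r) ≠ ∞ := measure_ball_lt_top.ne
        have hw0 := (measure_ball_pos volume (X t) hs).ne'
        have hwt : volume (ball (X t) (S t)) ≠ ∞ := measure_ball_lt_top.ne
        rw [← div_eq_mul_inv, ENNReal.le_div_iff_mul_le (Or.inl hv0) (Or.inl hvt), mul_comm,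
          ← div_eq_mul_inv, ENNReal.div_le_iff hw0 hwt]
        exact hvol
    _ = _ := by simp

/-- Poincaré estimate for a pair of intersecting balls of comparable
radii. If `B = B(x,ρ)`, `B' = B(x',ρ')` intersect and `c ρ' ≤ ρ ≤ C ρ'`, and
`λ = 1 + 2/c`, then `B' ⊆ λB`, and there is `A = A(n,c,C)` such that for any `u`
differentiable on `λB` with square-integrable gradient there,
`|u_B - u_{B'}|² ≤ (A/|B|) ρ² ∫_{λB} |∇u|²`. -/
theorem stmt7 (n : ℕ) (hn : 1 ≤ n) (c C : ℝ) (hc : 0 < c) (hcC : c ≤ C) :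
    ∃ A : ℝ, 0 < A ∧
      ∀ (x x' : En n) (ρ ρ' : ℝ),
        (ball x ρ ∩ ball x' ρ').Nonempty → c * ρ' ≤ ρ → ρ ≤ C * ρ' →
        ball x' ρ' ⊆ ball x ((1 + 2 / c) * ρ) ∧
        ∀ u : En n → ℝ,
          DifferentiableOn ℝ u (ball x ((1 + 2 / c) * ρ)) →
          IntegrableOn (fun y => ‖fderiv ℝ u y‖ ^ 2) (ball x ((1 + 2 / c) * ρ)) →
          |(⨍ y in ball x ρ, u y) - ⨍ y in ball x' ρ', u y| ^ 2 ≤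
            A / (volume (ball x ρ)).toReal * ρ ^ 2 *
              ∫ y in ball x ((1 + 2 / c) * ρ), ‖fderiv ℝ u y‖ ^ 2 := by
  refine ⟨(2 * (1 + 1 / c)) ^ 2 * (max 1 C) ^ n, by positivity, ?_⟩
  rintro x x' r r' ⟨w, hw, hw'⟩ h1 h2
  have hr : 0 < r := pos_of_mem_ball hw
  have hr' : 0 < r' := pos_of_mem_ball hw'
  have hxx : dist x' x < r + r' := by
    rw [mem_ball] at hw hw'
    have := dist_triangle_left x' x w
    linarith
  have hrc : r' ≤ r / c := by rw [le_div_iff₀ hc]; linarith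
  have hR : r + 2 * r' ≤ (1 + 2 / c) * r := by
    have : (1 + 2 / c) * r = r + 2 * (r / c) := by ring
    linarith
  have hM : 2 * (r + r') ≤ 2 * (1 + 1 / c) * r := by
    have : 2 * (1 + 1 / c) * r = 2 * (r + r / c) := by ring
    linarith
  refine ⟨fun y hy => ?_, fun u hu hint => ?_⟩
  · rw [mem_ball] at hy ⊢
    have := dist_triangle y x' x
    linarith
  have key := aux_main x x' r r' _ _ (max 1 C) hr hr' hxx hR hM (le_max_left _ _)
    (h2.trans (by gcongr; exact le_max_right _ _)) u hu
  have hI : ∫⁻ y in ball x ((1 + 2 / c) * r), ‖fderiv ℝ u y‖ₑ ^ 2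
      = ENNReal.ofReal (∫ y in ball x ((1 + 2 / c) * r), ‖fderiv ℝ u y‖ ^ 2) := by
    rw [ofReal_integral_eq_lintegral_ofReal hint (ae_of_all _ fun y => by positivity)]
    congr 1 with y
    rw [ENNReal.ofReal_pow (norm_nonneg _), ofReal_norm]
  have hv : 0 < (volume (ball x r)).toReal :=
    ENNReal.toReal_pos (measure_ball_pos volume x hr).ne' measure_ball_lt_top.ne
  have hvi : (volume (ball x r))⁻¹ = ENNReal.ofReal ((volume (ball x r)).toReal⁻¹) := by
    rw [ENNReal.ofReal_inv_of_pos hv, ENNReal.ofReal_toReal measure_ball_lt_top.ne]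
  have hnn : 0 ≤ ∫ y in ball x ((1 + 2 / c) * r), ‖fderiv ℝ u y‖ ^ 2 :=
    integral_nonneg fun y => by positivity
  rw [hI, hvi, ← ENNReal.ofReal_mul (by positivity), ← ENNReal.ofReal_mul (by positivity),
    ← ENNReal.ofReal_mul (by positivity), ← ofReal_norm, ← ENNReal.ofReal_pow (norm_nonneg _),
    ENNReal.ofReal_le_ofReal_iff (by positivity), Real.norm_eq_abs] at key
  refine key.trans (le_of_eq ?_)
  rw [div_eq_mul_inv]
  ring
end
end

section
/- Let n ≥ 3 and let Ω ⊂ ℝⁿ be a bounded open set whose boundary ∂Ω is Ahlfors regular with constants C₁, C₂. Fix φ ∈ C_c^∞(ℝⁿ) with 0 ≤ φ ≤ 1, φ ≡ 1 on B(0,1/2) and supp φ ⊂ B(0,1), set φ_ε(z) = ε^{1−n} φ(z/ε), and for a measurable f : ∂Ω → [0,1] define f_ε(x) = (∫_{∂Ω} f(y) φ_ε(x − y) dσ(y)) / (∫_{∂Ω} φ_ε(x − y) dσ(y)) for x ∈ ∂Ω. Then there exists C > 0, depending only on n, φ, C₁, C₂ and in particular independent of ε, such that ‖f_ε‖_{BMO(σ)}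 ≤ C ‖f‖_{BMO(σ)} for every 0 < ε ≤ diam Ω. -/
open MeasureTheory Metric Set Filter Bornology
open scoped ENNReal NNReal Topology

noncomputable section

/-- The normalized boundary mollification `f_ε` of `f` by `φ_ε(z) = ε^{1-n} φ(z/ε)`. -/
def mollify (n : ℕ) (Ω : Set (En n)) (φ : En n → ℝ) (ε : ℝ) (f : En n → ℝ)
    (x : En n) : ℝ :=
  (∫ y in frontier Ω, f y * ((ε ^ (n - 1))⁻¹ * φ (ε⁻¹ • (x - y))) ∂μH[(n : ℝ) - 1]) /
    ∫ y in frontier Ω, (ε ^ (n - 1))⁻¹ * φ (ε⁻¹ • (x - y)) ∂μH[(n : ℝ) - 1]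

/-- The BMO seminorm of `g : ∂Ω → ℝ` with respect to `σ = H^{n-1}|_{∂Ω}`:
`‖g‖_{BMO(σ)} = sup_{Δ = Δ(Q,s), 0 < s ≤ diam Ω} inf_{λ ∈ ℝ} σ(Δ)⁻¹ ∫_Δ |g - λ| dσ`. -/
def bmoNorm (n : ℕ) (Ω : Set (En n)) (g : En n → ℝ) : ℝ :=
  sSup {v : ℝ | ∃ Q ∈ frontier Ω, ∃ s : ℝ, 0 < s ∧ s ≤ diam Ω ∧
    v = ⨅ lam : ℝ, (μH[(n : ℝ) - 1] (ball Q s ∩ frontier Ω)).toReal⁻¹ *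
      ∫ y in ball Q s ∩ frontier Ω, |g y - lam| ∂μH[(n : ℝ) - 1]}

/-- The intersection of two distinct spheres of equal radius is `H^{n-1}`-null. -/
lemma aux_sphere (n : ℕ) (hn : 3 ≤ n) (Q Q' : En n) (h : Q ≠ Q') (D : ℝ) :
    μH[(n : ℝ) - 1] (sphere Q D ∩ sphere Q' D) = 0 := by
  obtain ⟨k, rfl⟩ : ∃ k, n = k + 1 := ⟨n - 1, by omega⟩
  have hv : Q' - Q ≠ 0 := sub_ne_zero.mpr h.symm
  have : Fact (Module.finrank ℝ (En (k + 1)) = k + 1) := ⟨by simp [En]⟩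
  set V : Submodule ℝ (En (k + 1)) := (Submodule.span ℝ {Q' - Q})ᗮ with hV
  have hfin : Module.finrank ℝ V = k := Submodule.finrank_orthogonal_span_singleton hv
  have : Nontrivial V := Module.nontrivial_of_finrank_pos (R := ℝ) (by omega)
  set m : En (k + 1) := (1 / 2 : ℝ) • (Q + Q') with hm
  set ρ := Real.sqrt (D ^ 2 - ‖m - Q‖ ^ 2) with hρ
  let F : V → En (k + 1) := fun v => m + (v : En (k + 1))
  have hF : Isometry F := by
    intro a b
    simp only [F, edist_add_left]
    rfl
  have hdim : (((k + 1 : ℕ) : ℝ) - 1) = (Module.finrank ℝ V : ℝ) := by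
    rw [hfin]; push_cast; ring
  have hsub : sphere Q D ∩ sphere Q' D ⊆ F '' sphere (0 : V) ρ := by
    rintro x ⟨hx, hx'⟩
    rw [mem_sphere, dist_eq_norm] at hx hx'
    have e1 : x - Q = (x - m) + (1 / 2 : ℝ) • (Q' - Q) := by rw [hm]; module
    have e2 : x - Q' = (x - m) - (1 / 2 : ℝ) • (Q' - Q) := by rw [hm]; module
    have e3 : m - Q = (1 / 2 : ℝ) • (Q' - Q) := by rw [hm]; module
    have n1 : ‖x - Q‖ ^ 2 = ‖x - m‖ ^ 2 + 2 * inner ℝ (x - m) ((1 / 2 : ℝ) • (Q' - Q))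
        + ‖(1 / 2 : ℝ) • (Q' - Q)‖ ^ 2 := by rw [e1]; exact norm_add_sq_real _ _
    have n2 : ‖x - Q'‖ ^ 2 = ‖x - m‖ ^ 2 - 2 * inner ℝ (x - m) ((1 / 2 : ℝ) • (Q' - Q))
        + ‖(1 / 2 : ℝ) • (Q' - Q)‖ ^ 2 := by rw [e2]; exact norm_sub_sq_real _ _
    rw [hx] at n1
    rw [hx'] at n2
    have n3 : inner ℝ (x - m) ((1 / 2 : ℝ) • (Q' - Q)) = 0 := by linarith
    have n4 : ‖x - m‖ ^ 2 = D ^ 2 - ‖m - Q‖ ^ 2 := by rw [e3]; linarith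
    have n5 : inner ℝ (x - m) (Q' - Q) = 0 := by
      rw [inner_smul_right] at n3; linarith
    refine ⟨⟨x - m, ?_⟩, ?_, ?_⟩
    · rw [hV, Submodule.mem_orthogonal_singleton_iff_inner_left]
      exact n5
    · rw [mem_sphere, dist_zero_right, hρ, ← n4, Real.sqrt_sq (norm_nonneg _)]
      rfl
    · simp [F]
  refine measure_mono_null hsub ?_
  rw [hF.hausdorffMeasure_image (Or.inl (by rw [hdim]; positivity)), hdim]
  exact Measure.addHaar_sphere _ _ _

/-- Tonelli estimate for averaged functions. -/
lemma aux_tonelli {n : ℕ} (μ : Measure (En n)) [IsFiniteMeasure μ] (g h : En n → ℝ)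
    (hg : Measurable g) (hg0 : ∀ x, 0 ≤ g x) (hgi : Integrable g μ) (Q : En n) (s ε c u : ℝ)
    (hc : 0 ≤ c) (hu : 0 ≤ u)
    (hh : ∀ᵐ x ∂μ, |h x| ≤ c * ∫ y in ball x ε, g y ∂μ)
    (hμ : ∀ᵐ y ∂μ, μ (ball y ε) ≤ ENNReal.ofReal u) :
    ∫ x in ball Q s, |h x| ∂μ ≤ c * (u * ∫ y in ball Q (s + ε), g y ∂μ) := by
  have h1 := norm_integral_le_lintegral_norm (μ := μ.restrict (ball Q s)) (fun x => |h x|)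
  refine (le_abs_self _).trans (h1.trans ?_)
  have hI : 0 ≤ ∫ y in ball Q (s + ε), g y ∂μ := integral_nonneg hg0
  refine ENNReal.toReal_le_of_le_ofReal (by positivity) ?_
  let k : En n → En n → ℝ≥0∞ := fun x y =>
    {p : En n × En n | dist p.1 p.2 < ε}.indicator (fun p => ENNReal.ofReal (g p.2)) (x, y)
  have hk : Measurable (Function.uncurry k) := by
    apply Measurable.indicator
    · fun_prop
    · exact measurableSet_lt (by fun_prop) (by fun_prop)
  calc ∫⁻ x in ball Q s, ENNReal.ofReal ‖|h x|‖ ∂μ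
      ≤ ∫⁻ x in ball Q s, ENNReal.ofReal c * ∫⁻ y, k x y ∂μ ∂μ := by
        refine lintegral_mono_ae (ae_restrict_of_ae ?_)
        filter_upwards [hh] with x hx
        rw [Real.norm_eq_abs, abs_abs]
        refine (ENNReal.ofReal_le_ofReal hx).trans ?_
        rw [ENNReal.ofReal_mul hc, ofReal_integral_eq_lintegral_ofReal hgi.restrict
          (ae_of_all _ hg0), ← lintegral_indicator measurableSet_ball]
        gcongr with y
        simp only [k, indicator, mem_ball, mem_ofPred_eq, dist_comm y x]
        exact le_rfl
    _ = ENNReal.ofReal c * ∫⁻ y, ∫⁻ x in ball Q s, k x y ∂μ ∂μ := by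
        rw [lintegral_const_mul _ (Measurable.lintegral_prod_right hk),
          lintegral_lintegral_swap hk.aemeasurable]
    _ ≤ ENNReal.ofReal c * ∫⁻ y, (ball Q (s + ε)).indicator
          (fun y => ENNReal.ofReal u * ENNReal.ofReal (g y)) y ∂μ := by
        gcongr 1
        refine lintegral_mono_ae ?_
        filter_upwards [hμ] with y hy
        by_cases hyQ : y ∈ ball Q (s + ε)
        · rw [indicator_of_mem hyQ]
          calc ∫⁻ x in ball Q s, k x y ∂μ ≤ ∫⁻ x, k x y ∂μ := setLIntegral_le_lintegral _ _
            _ = ∫⁻ x, (ball y ε).indicator (fun _ => ENNReal.ofReal (g y)) x ∂μ := by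
                congr 1
            _ = ENNReal.ofReal (g y) * μ (ball y ε) := by
                rw [lintegral_indicator measurableSet_ball, lintegral_const]; simp
            _ ≤ ENNReal.ofReal u * ENNReal.ofReal (g y) := by
                rw [mul_comm]; gcongr
        · rw [indicator_of_notMem hyQ]
          refine le_of_eq ?_
          refine (setLIntegral_congr_fun (g := fun _ => 0) measurableSet_ball
            fun x hx => ?_).trans (by simp)
          simp only [k, indicator, mem_ofPred_eq, ite_eq_right_iff]
          intro hxy
          exfalso
          apply hyQ
          rw [mem_ball] at hx ⊢
          have := dist_triangle y x Q
          rw [dist_comm y x] at this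
          linarith
    _ = ENNReal.ofReal (c * (u * ∫ y in ball Q (s + ε), g y ∂μ)) := by
        rw [lintegral_indicator measurableSet_ball, lintegral_const_mul _ (by fun_prop),
          ENNReal.ofReal_mul hc, ENNReal.ofReal_mul hu,
          ofReal_integral_eq_lintegral_ofReal hgi.restrict (ae_of_all _ hg0)]

/-- Pointwise bound of the mollification. -/
lemma aux_pointwise {n : ℕ} (μ : Measure (En n)) [IsFiniteMeasure μ] (f φ : En n → ℝ)
    (hf : Integrable f μ) (hφ : Continuous φ)
    (hφ01 : ∀ z, φ z ∈ Icc (0 : ℝ) 1) (hφ1 : ∀ z ∈ ball (0 : En n) (1 / 2), φ z = 1)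
    (hφsupp : Function.support φ ⊆ ball (0 : En n) 1) (e ε b lam : ℝ) (he : 0 < e) (hε : 0 < ε)
    (hb : 0 < b) (x : En n) (hx : b ≤ e * μ.real (ball x (ε / 2))) :
    |(∫ y, f y * (e * φ (ε⁻¹ • (x - y))) ∂μ) / (∫ y, e * φ (ε⁻¹ • (x - y)) ∂μ) - lam| ≤
      (b⁻¹ * e) * ∫ y in ball x ε, |f y - lam| ∂μ := by
  set k : En n → ℝ := fun y => e * φ (ε⁻¹ • (x - y)) with hk
  have hkm : Continuous k := by fun_prop
  have hk0 : ∀ y, 0 ≤ k y := fun y => mul_nonneg he.le (hφ01 _).1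
  have hke : ∀ y, k y ≤ e := fun y => mul_le_of_le_one_right he.le (hφ01 _).2
  have hkb : ∀ᵐ y ∂μ, ‖k y‖ ≤ e := ae_of_all _ fun y => by
    rw [Real.norm_eq_abs, abs_of_nonneg (hk0 y)]; exact hke y
  have hki : Integrable k μ := Integrable.of_bound hkm.aestronglyMeasurable e hkb
  have hfk : Integrable (fun y => f y * k y) μ := hf.mul_bdd hkm.aestronglyMeasurable hkb
  have hden : b ≤ ∫ y, k y ∂μ := by
    refine hx.trans ?_
    calc e * μ.real (ball x (ε / 2)) = ∫ y in ball x (ε / 2), e ∂μ := by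
          rw [setIntegral_const, smul_eq_mul, mul_comm]
      _ = ∫ y in ball x (ε / 2), k y ∂μ := by
          refine setIntegral_congr_fun measurableSet_ball fun y hy => ?_
          have : φ (ε⁻¹ • (x - y)) = 1 := by
            apply hφ1
            rw [mem_ball, dist_zero_right, norm_smul, norm_inv, Real.norm_eq_abs, abs_of_pos hε,
              ← dist_eq_norm, dist_comm, inv_mul_lt_iff₀ hε]
            rw [mem_ball] at hy
            linarith
          simp [hk, this]
      _ ≤ ∫ y, k y ∂μ := setIntegral_le_integral hki (ae_of_all _ hk0)
  have hdpos : 0 < ∫ y, k y ∂μ := hb.trans_le hden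
  have hfl : Integrable (fun y => |f y - lam|) μ := (hf.sub (integrable_const lam)).abs
  have hG : |(∫ y, f y * k y ∂μ) - lam * ∫ y, k y ∂μ| ≤ e * ∫ y in ball x ε, |f y - lam| ∂μ := by
    rw [← integral_const_mul, ← integral_sub hfk (hki.const_mul _)]
    refine (abs_integral_le_integral_abs).trans ?_
    rw [← integral_const_mul, ← integral_indicator measurableSet_ball]
    refine integral_mono_ae ((hfk.sub (hki.const_mul _)).abs)
      ((hfl.const_mul e).indicator measurableSet_ball) (ae_of_all _ fun y => ?_)
    have e1 : f y * k y - lam * k y = (f y - lam) * k y := by ring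
    simp only [e1, abs_mul, abs_of_nonneg (hk0 y)]
    by_cases hy : y ∈ ball x ε
    · rw [indicator_of_mem hy, mul_comm]
      exact mul_le_mul_of_nonneg_right (hke y) (abs_nonneg _)
    · rw [indicator_of_notMem hy]
      have : φ (ε⁻¹ • (x - y)) = 0 := by
        by_contra hne
        have := hφsupp hne
        rw [mem_ball, dist_zero_right, norm_smul, norm_inv, Real.norm_eq_abs, abs_of_pos hε,
              ← dist_eq_norm, dist_comm, inv_mul_lt_iff₀ hε, mul_one] at this
        exact hy this
      simp [hk, this]
  have e2 : (∫ y, f y * k y ∂μ) / (∫ y, k y ∂μ) - lam =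
      ((∫ y, f y * k y ∂μ) - lam * ∫ y, k y ∂μ) / ∫ y, k y ∂μ := by field_simp
  rw [e2, abs_div, abs_of_pos hdpos, div_eq_inv_mul, mul_assoc]
  gcongr

/-- Oscillation over the whole boundary. -/
lemma aux_whole {n : ℕ} (μ : Measure (En n)) [IsFiniteMeasure μ] (f : En n → ℝ)
    (hf : Integrable f μ) (Q Q' : En n) (D T a q q' : ℝ) (ha : 0 < a)
    (hdist : dist Q Q' < D / 2) (hcov : ∀ᵐ x ∂μ, x ∈ ball Q D ∪ ball Q' D)
    (h1 : ∫ y in ball Q D, |f y - q| ∂μ ≤ T) (h2 : ∫ y in ball Q' D, |f y - q'| ∂μ ≤ T)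
    (hlow : a ≤ μ.real (ball Q (D / 2))) :
    ∫ y, |f y - q| ∂μ ≤ 2 * T + μ.real (ball Q' D) * (a⁻¹ * (2 * T)) := by
  have hi : ∀ c, Integrable (fun y => |f y - c|) μ := fun c =>
    (hf.sub (integrable_const c)).abs
  have hD : 0 < D := by linarith [dist_nonneg (x := Q) (y := Q')]
  have hdiff : |q - q'| ≤ a⁻¹ * (2 * T) := by
    rw [le_inv_mul_iff₀ ha]
    calc a * |q - q'| ≤ μ.real (ball Q (D / 2)) * |q - q'| := by gcongr
      _ = ∫ y in ball Q (D / 2), |q - q'| ∂μ := by rw [setIntegral_const, smul_eq_mul]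
      _ ≤ ∫ y in ball Q (D / 2), (|f y - q| + |f y - q'|) ∂μ := by
          refine integral_mono (integrable_const _) ((hi q).restrict.add (hi q').restrict)
            fun y => ?_
          have := abs_sub_le q (f y) q'
          rw [abs_sub_comm q (f y)] at this
          exact this
      _ = ∫ y in ball Q (D / 2), |f y - q| ∂μ + ∫ y in ball Q (D / 2), |f y - q'| ∂μ :=
          integral_add (hi q).restrict (hi q').restrict
      _ ≤ ∫ y in ball Q D, |f y - q| ∂μ + ∫ y in ball Q' D, |f y - q'| ∂μ := by
          refine add_le_add ?_ ?_
          · exact setIntegral_mono_set (hi q).restrict (ae_of_all _ fun _ => abs_nonneg _)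
              (LE.le.eventuallyLE (ball_subset_ball (by linarith)))
          · exact setIntegral_mono_set (hi q').restrict (ae_of_all _ fun _ => abs_nonneg _)
              (LE.le.eventuallyLE (ball_subset_ball' (by linarith)))
      _ ≤ 2 * T := by linarith
  calc ∫ y, |f y - q| ∂μ = ∫ y in ball Q D ∪ ball Q' D, |f y - q| ∂μ := by
        rw [Measure.restrict_eq_self_of_ae_mem hcov]
    _ ≤ ∫ y in ball Q D, |f y - q| ∂μ + ∫ y in ball Q' D, |f y - q| ∂μ := by
        rw [← integral_indicator (measurableSet_ball.union measurableSet_ball),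
          ← integral_indicator measurableSet_ball, ← integral_indicator measurableSet_ball,
          ← integral_add ((hi q).indicator measurableSet_ball)
            ((hi q).indicator measurableSet_ball)]
        refine integral_mono ((hi q).indicator (measurableSet_ball.union measurableSet_ball))
          (((hi q).indicator measurableSet_ball).add
            ((hi q).indicator measurableSet_ball)) fun y => ?_
        have := abs_nonneg (f y - q)
        by_cases hy : y ∈ ball Q D <;> by_cases hy' : y ∈ ball Q' D <;>
          simp [indicator, -mem_ball, hy, hy', this]
    _ ≤ T + ∫ y in ball Q' D, (|f y - q'| + |q - q'|) ∂μ := by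
        refine add_le_add h1 (integral_mono (hi q).restrict
          ((hi q').restrict.add (integrable_const _)) fun y => ?_)
        have := abs_sub_le (f y) q' q
        rw [abs_sub_comm q' q] at this
        exact this
    _ = T + (∫ y in ball Q' D, |f y - q'| ∂μ + μ.real (ball Q' D) * |q - q'|) := by
        rw [integral_add (hi q').restrict (integrable_const _), setIntegral_const, smul_eq_mul]
    _ ≤ 2 * T + μ.real (ball Q' D) * (a⁻¹ * (2 * T)) := by
        have : μ.real (ball Q' D) * |q - q'| ≤ μ.real (ball Q' D) * (a⁻¹ * (2 * T)) := by gcongr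
        linarith

/-- Core estimate, in terms of the finite measure `μ = σ`. -/
lemma aux_core {n : ℕ} (μ : Measure (En n)) [IsFiniteMeasure μ] (K : Set (En n))
    (hK : ∀ᵐ x ∂μ, x ∈ K) (m : ℕ) (C₁ C₂ D A N ε : ℝ) (hC₁ : 0 < C₁) (hC₁₂ : C₁ ≤ C₂)
    (hA : 0 < A) (hN : 0 ≤ N) (hε : 0 < ε) (hεD : ε ≤ D)
    (hlow : ∀ Q ∈ K, ∀ r, 0 < r → r ≤ D → C₁ * r ^ m ≤ μ.real (ball Q r))
    (hup : ∀ Q ∈ K, ∀ r, 0 < r → r ≤ D → μ.real (ball Q r) ≤ C₂ * r ^ m)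
    (f φ : En n → ℝ) (hfm : Measurable f) (hf : Integrable f μ) (hφ : Continuous φ)
    (hφ01 : ∀ z, φ z ∈ Icc (0 : ℝ) 1) (hφ1 : ∀ z ∈ ball (0 : En n) (1 / 2), φ z = 1)
    (hφsupp : Function.support φ ⊆ ball (0 : En n) 1)
    (hosc : ∀ Q ∈ K, ∀ r, 0 < r → ∃ lam, ∫ y in ball Q r, |f y - lam| ∂μ ≤ A * r ^ m * N)
    (Q : En n) (hQ : Q ∈ K) (s : ℝ) (hs : 0 < s) (hsD : s ≤ D) :
    ∃ lam, (μ.real (ball Q s))⁻¹ * ∫ x in ball Q s,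
      |(∫ y, f y * ((ε ^ m)⁻¹ * φ (ε⁻¹ • (x - y))) ∂μ) /
        (∫ y, (ε ^ m)⁻¹ * φ (ε⁻¹ • (x - y)) ∂μ) - lam| ∂μ ≤
      (4 ^ m * A * C₂ / C₁ ^ 2) * N := by
  have hi : ∀ c, Integrable (fun y => |f y - c|) μ := fun c =>
    (hf.sub (integrable_const c)).abs
  have hpt : ∀ lam, ∀ x ∈ K, |(∫ y, f y * ((ε ^ m)⁻¹ * φ (ε⁻¹ • (x - y))) ∂μ) /
        (∫ y, (ε ^ m)⁻¹ * φ (ε⁻¹ • (x - y)) ∂μ) - lam| ≤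
        ((C₁ / 2 ^ m)⁻¹ * (ε ^ m)⁻¹) * ∫ y in ball x ε, |f y - lam| ∂μ := by
    intro lam x hx
    refine aux_pointwise μ f φ hf hφ hφ01 hφ1 hφsupp (ε ^ m)⁻¹ ε (C₁ / 2 ^ m) lam
      (by positivity) hε (by positivity) x ?_
    rw [le_inv_mul_iff₀ (by positivity)]
    refine le_trans (le_of_eq ?_) (hlow x hx (ε / 2) (by positivity) (by linarith))
    rw [div_pow]; ring
  have hσ : 0 < μ.real (ball Q s) := lt_of_lt_of_le (by positivity) (hlow Q hQ s hs hsD)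
  have h4 : (4 : ℝ) ^ m = 2 ^ m * 2 ^ m := by rw [← mul_pow]; norm_num
  rcases le_total s ε with hsε | hεs
  · obtain ⟨lam, hlam⟩ := hosc Q hQ (2 * ε) (by positivity)
    refine ⟨lam, ?_⟩
    rw [inv_mul_le_iff₀ hσ]
    have hbd : ∀ᵐ x ∂μ.restrict (ball Q s), ‖|(∫ y, f y * ((ε ^ m)⁻¹ * φ (ε⁻¹ • (x - y))) ∂μ) /
        (∫ y, (ε ^ m)⁻¹ * φ (ε⁻¹ • (x - y)) ∂μ) - lam|‖ ≤ (4 ^ m * A * C₂ / C₁ ^ 2) * N := by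
      filter_upwards [ae_restrict_of_ae hK, ae_restrict_mem measurableSet_ball] with x hx hxs
      rw [Real.norm_eq_abs, abs_abs]
      refine (hpt lam x hx).trans ?_
      have hsub : ∫ y in ball x ε, |f y - lam| ∂μ ≤ A * (2 * ε) ^ m * N := by
        refine le_trans ?_ hlam
        refine setIntegral_mono_set (hi lam).restrict (ae_of_all _ fun _ => abs_nonneg _)
              (LE.le.eventuallyLE (ball_subset_ball' ?_))
        rw [mem_ball] at hxs
        linarith
      calc _ ≤ ((C₁ / 2 ^ m)⁻¹ * (ε ^ m)⁻¹) * (A * (2 * ε) ^ m * N) := by gcongr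
        _ = (4 ^ m * A * C₁ / C₁ ^ 2) * N := by
            rw [h4, mul_pow]; field_simp
        _ ≤ _ := by gcongr
    have := norm_integral_le_of_norm_le_const hbd
    refine (le_abs_self _).trans (this.trans (le_of_eq ?_))
    rw [mul_comm]
    simp [Measure.real]
  · obtain ⟨lam, hlam⟩ := hosc Q hQ (2 * s) (by positivity)
    refine ⟨lam, ?_⟩
    have hC₂ : 0 < C₂ := hC₁.trans_le hC₁₂
    have ht := aux_tonelli μ (fun y => |f y - lam|) (fun x => (∫ y, f y * ((ε ^ m)⁻¹ *
        φ (ε⁻¹ • (x - y))) ∂μ) / (∫ y, (ε ^ m)⁻¹ * φ (ε⁻¹ • (x - y)) ∂μ) - lam)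
        (by fun_prop) (fun _ => abs_nonneg _) (hi lam) Q s ε
        ((C₁ / 2 ^ m)⁻¹ * (ε ^ m)⁻¹) (C₂ * ε ^ m) (by positivity) (by positivity)
        (hK.mono fun x hx => hpt lam x hx)
        (hK.mono fun y hy => by
          rw [← ofReal_measureReal]
          exact ENNReal.ofReal_le_ofReal (hup y hy ε hε hεD))
    have hsub : ∫ y in ball Q (s + ε), |f y - lam| ∂μ ≤ A * (2 * s) ^ m * N := by
      refine le_trans ?_ hlam
      exact setIntegral_mono_set (hi lam).restrict (ae_of_all _ fun _ => abs_nonneg _)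
              (LE.le.eventuallyLE (ball_subset_ball (by linarith)))
    rw [inv_mul_le_iff₀ hσ]
    refine ht.trans ?_
    calc _ ≤ ((C₁ / 2 ^ m)⁻¹ * (ε ^ m)⁻¹) * (C₂ * ε ^ m * (A * (2 * s) ^ m * N)) := by gcongr
      _ = (C₁ * s ^ m) * ((4 ^ m * A * C₂ / C₁ ^ 2) * N) := by
          rw [h4, mul_pow]; field_simp
      _ ≤ _ := by
          have := hlow Q hQ s hs hsD
          gcongr

/-- the normalized mollifications are uniformly bounded in BMO:
`‖f_ε‖_{BMO(σ)} ≤ C ‖f‖_{BMO(σ)}` for all `0 < ε ≤ diam Ω`, with `C` depending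
only on `n, φ, C₁, C₂` (in particular, independent of `ε`). -/
theorem stmt15 (n : ℕ) (hn : 3 ≤ n) (C₁ C₂ : ℝ) (hC₁ : 0 < C₁) (hC₁₂ : C₁ ≤ C₂)
    (φ : En n → ℝ) (hφ : ContDiff ℝ (⊤ : ℕ∞) φ) (hφc : HasCompactSupport φ)
    (hφ01 : ∀ z, φ z ∈ Icc (0 : ℝ) 1) (hφ1 : ∀ z ∈ ball (0 : En n) (1 / 2), φ z = 1)
    (hφsupp : Function.support φ ⊆ ball (0 : En n) 1) :
    ∃ C : ℝ, 0 < C ∧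
      ∀ Ω : Set (En n), IsOpen Ω → IsBounded Ω → AhlforsRegular n Ω C₁ C₂ →
        ∀ f : En n → ℝ, Measurable f → (∀ y ∈ frontier Ω, f y ∈ Icc (0 : ℝ) 1) →
          ∀ ε : ℝ, 0 < ε → ε ≤ diam Ω →
            bmoNorm n Ω (mollify n Ω φ ε f) ≤ C * bmoNorm n Ω f := by
  have hC₂ : 0 < C₂ := hC₁.trans_le hC₁₂
  set A : ℝ := 2 * C₂ + C₂ * ((C₁ / 2 ^ (n - 1))⁻¹ * (2 * C₂)) with hAdef
  have hA : 0 < A := by positivity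
  have hAC : C₂ ≤ A := by
    have : 0 < C₂ * ((C₁ / 2 ^ (n - 1))⁻¹ * (2 * C₂)) := by positivity
    linarith
  have hC : 0 < 4 ^ (n - 1) * A * C₂ / C₁ ^ 2 := by positivity
  refine ⟨4 ^ (n - 1) * A * C₂ / C₁ ^ 2, hC, ?_⟩
  intro Ω hΩ hΩb hAR f hfm hf01 ε hε hεD
  set K := frontier Ω with hKdef
  set D := diam Ω with hDdef
  have hD : 0 < D := hε.trans_le hεD
  have hKc : IsCompact K := Metric.isCompact_of_isClosed_isBounded isClosed_frontier
    (hΩb.closure.subset frontier_subset_closure)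
  have hKdiam : ∀ x ∈ K, ∀ y ∈ K, dist x y ≤ D := by
    intro x hx y hy
    rw [hDdef, ← Metric.diam_closure]
    exact dist_le_diam_of_mem hΩb.closure (frontier_subset_closure hx) (frontier_subset_closure hy)
  have hKfin : μH[(n : ℝ) - 1] K < ∞ := by
    refine hKc.measure_lt_top_of_nhdsWithin fun x hx => ?_
    refine ⟨ball x D ∩ K, ?_, (hAR x hx D hD le_rfl).2.trans_lt ENNReal.ofReal_lt_top⟩
    exact inter_mem (mem_nhdsWithin_of_mem_nhds (ball_mem_nhds x hD)) self_mem_nhdsWithin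
  set μ : Measure (En n) := (μH[(n : ℝ) - 1]).restrict K with hμ
  have : IsFiniteMeasure μ := ⟨by rw [hμ, Measure.restrict_apply_univ]; exact hKfin⟩
  have hKm : ∀ᵐ x ∂μ, x ∈ K := ae_restrict_mem isClosed_frontier.measurableSet
  have hball : ∀ Q r, μH[(n : ℝ) - 1] (ball Q r ∩ K) = μ (ball Q r) := fun Q r => by
    rw [hμ, Measure.restrict_apply measurableSet_ball]
  have hrest : ∀ Q r, (μH[(n : ℝ) - 1]).restrict (ball Q r ∩ K) = μ.restrict (ball Q r) :=
    fun Q r => by rw [hμ, Measure.restrict_restrict measurableSet_ball]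
  have hlow : ∀ Q ∈ K, ∀ r, 0 < r → r ≤ D → C₁ * r ^ (n - 1) ≤ μ.real (ball Q r) := by
    intro Q hQ r hr hrD
    have := (hAR Q hQ r hr hrD).1
    rw [hball] at this
    exact (ENNReal.ofReal_le_iff_le_toReal (measure_ne_top _ _)).1 this
  have hup : ∀ Q ∈ K, ∀ r, 0 < r → r ≤ D → μ.real (ball Q r) ≤ C₂ * r ^ (n - 1) := by
    intro Q hQ r hr hrD
    have := (hAR Q hQ r hr hrD).2
    rw [hball] at this
    exact ENNReal.toReal_le_of_le_ofReal (by positivity) this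
  have hf : Integrable f μ := by
    refine Integrable.of_bound hfm.aestronglyMeasurable 1 ?_
    filter_upwards [hKm] with x hx
    rw [Real.norm_eq_abs, abs_le]
    constructor <;> linarith [(hf01 x hx).1, (hf01 x hx).2]
  have hi : ∀ c, Integrable (fun y => |f y - c|) μ := fun c =>
    (hf.sub (integrable_const c)).abs
  have hbmo : ∀ g, bmoNorm n Ω g = sSup {v : ℝ | ∃ Q ∈ K, ∃ s : ℝ, 0 < s ∧ s ≤ D ∧
      v = ⨅ lam : ℝ, (μ.real (ball Q s))⁻¹ * ∫ y in ball Q s, |g y - lam| ∂μ} := by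
    intro g
    simp only [bmoNorm, ← hKdef, ← hDdef, hball, hrest, Measure.real]
  have hbelow : ∀ (g : En n → ℝ) (Q : En n) (s : ℝ), BddBelow (range fun lam : ℝ =>
      (μ.real (ball Q s))⁻¹ * ∫ y in ball Q s, |g y - lam| ∂μ) := by
    intro g Q s
    refine ⟨0, ?_⟩
    rintro _ ⟨lam, rfl⟩
    exact mul_nonneg (inv_nonneg.2 measureReal_nonneg) (integral_nonneg fun _ => abs_nonneg _)
  have hM0 : 0 ≤ bmoNorm n Ω f := by
    rw [hbmo]
    refine Real.sSup_nonneg ?_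
    rintro v ⟨Q, hQ, s, hs, hsD, rfl⟩
    exact Real.iInf_nonneg fun lam =>
      mul_nonneg (inv_nonneg.2 measureReal_nonneg) (integral_nonneg fun _ => abs_nonneg _)
  have hM : ∀ Q ∈ K, ∀ s, 0 < s → s ≤ D → (⨅ lam : ℝ, (μ.real (ball Q s))⁻¹ *
      ∫ y in ball Q s, |f y - lam| ∂μ) ≤ bmoNorm n Ω f := by
    intro Q hQ s hs hsD
    rw [hbmo]
    refine le_csSup ⟨1, ?_⟩ ⟨Q, hQ, s, hs, hsD, rfl⟩
    rintro v ⟨Q, hQ, s, hs, hsD, rfl⟩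
    refine (ciInf_le (hbelow f Q s) 0).trans ?_
    have hσ : 0 < μ.real (ball Q s) := lt_of_lt_of_le (by positivity) (hlow Q hQ s hs hsD)
    rw [inv_mul_le_iff₀ hσ, mul_one]
    calc ∫ y in ball Q s, |f y - 0| ∂μ ≤ ∫ y in ball Q s, (1 : ℝ) ∂μ := by
          refine integral_mono_ae (hi 0).restrict (integrable_const _) ?_
          filter_upwards [ae_restrict_of_ae hKm] with x hx
          rw [sub_zero, abs_le]
          constructor <;> linarith [(hf01 x hx).1, (hf01 x hx).2]
      _ = μ.real (ball Q s) := by simp [Measure.real]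
  have key : ∀ N, bmoNorm n Ω f < N →
      bmoNorm n Ω (mollify n Ω φ ε f) ≤ (4 ^ (n - 1) * A * C₂ / C₁ ^ 2) * N := by
    intro N hN
    have hN0 : 0 < N := hM0.trans_lt hN
    have hosc0 : ∀ Q ∈ K, ∀ r, 0 < r → r ≤ D →
        ∃ lam, ∫ y in ball Q r, |f y - lam| ∂μ ≤ C₂ * r ^ (n - 1) * N := by
      intro Q hQ r hr hrD
      obtain ⟨lam, hlam⟩ := exists_lt_of_ciInf_lt ((hM Q hQ r hr hrD).trans_lt hN)
      refine ⟨lam, ?_⟩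
      have hσ : 0 < μ.real (ball Q r) := lt_of_lt_of_le (by positivity) (hlow Q hQ r hr hrD)
      rw [inv_mul_lt_iff₀ hσ] at hlam
      refine hlam.le.trans ?_
      have := hup Q hQ r hr hrD
      gcongr
    have hosc : ∀ Q ∈ K, ∀ r, 0 < r →
        ∃ lam, ∫ y in ball Q r, |f y - lam| ∂μ ≤ A * r ^ (n - 1) * N := by
      intro Q hQ r hr
      rcases le_or_gt r D with hrD | hDr
      · obtain ⟨lam, hlam⟩ := hosc0 Q hQ r hr hrD
        exact ⟨lam, hlam.trans (by gcongr)⟩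
      · obtain ⟨Q', hQ'K, hQ', hne⟩ : ∃ Q' ∈ K, dist Q Q' < D / 2 ∧ Q ≠ Q' := by
          by_contra hcon
          push Not at hcon
          have hsub : ball Q (D / 2) ∩ K ⊆ {Q} := by
            rintro x ⟨hx, hxK⟩
            rw [mem_ball, dist_comm] at hx
            exact (hcon x hxK hx).symm
          have hn3 : (3 : ℝ) ≤ n := by exact_mod_cast hn
          have := Measure.nullSingletonClass_hausdorff (En n) (d := (n : ℝ) - 1) (by linarith)
          have h0 : μ (ball Q (D / 2)) = 0 := by
            rw [← hball]
            exact measure_mono_null hsub (measure_singleton Q)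
          have h1 := hlow Q hQ (D / 2) (by positivity) (by linarith)
          rw [Measure.real, h0, ENNReal.toReal_zero] at h1
          have : 0 < C₁ * (D / 2) ^ (n - 1) := by positivity
          linarith
        have hcov : ∀ᵐ x ∂μ, x ∈ ball Q D ∪ ball Q' D := by
          have hnull : μ (sphere Q D ∩ sphere Q' D) = 0 :=
            Measure.absolutelyContinuous_of_le Measure.restrict_le_self
              (aux_sphere n hn Q Q' hne D)
          filter_upwards [hKm, measure_eq_zero_iff_ae_notMem.1 hnull] with x hx hxs
          by_contra hcon
          rw [mem_union, mem_ball, mem_ball, not_or, not_lt, not_lt] at hcon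
          exact hxs ⟨le_antisymm (hKdiam x hx Q hQ) hcon.1,
            le_antisymm (hKdiam x hx Q' hQ'K) hcon.2⟩
        obtain ⟨q, hq⟩ := hosc0 Q hQ D hD le_rfl
        obtain ⟨q', hq'⟩ := hosc0 Q' hQ'K D hD le_rfl
        have hw := aux_whole μ f hf Q Q' D (C₂ * D ^ (n - 1) * N) (C₁ * (D / 2) ^ (n - 1)) q q'
          (by positivity) hQ' hcov hq hq' (hlow Q hQ (D / 2) (by positivity) (by linarith))
        refine ⟨q, ?_⟩
        calc ∫ y in ball Q r, |f y - q| ∂μ ≤ ∫ y, |f y - q| ∂μ :=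
              setIntegral_le_integral (hi q) (ae_of_all _ fun _ => abs_nonneg _)
          _ ≤ _ := hw
          _ ≤ 2 * (C₂ * D ^ (n - 1) * N) + (C₂ * D ^ (n - 1)) *
              ((C₁ * (D / 2) ^ (n - 1))⁻¹ * (2 * (C₂ * D ^ (n - 1) * N))) := by
              have := hup Q' hQ'K D hD le_rfl
              gcongr
          _ = A * D ^ (n - 1) * N := by
              rw [hAdef, div_pow]; field_simp
          _ ≤ A * r ^ (n - 1) * N := by gcongr
    rw [hbmo]
    refine Real.sSup_le ?_ (by positivity)
    rintro v ⟨Q, hQ, s, hs, hsD, rfl⟩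
    obtain ⟨lam, hlam⟩ := aux_core μ K hKm (n - 1) C₁ C₂ D A N ε hC₁ hC₁₂ hA hN0.le hε hεD hlow hup
      f φ hfm hf hφ.continuous hφ01 hφ1 hφsupp hosc Q hQ s hs hsD
    exact (ciInf_le (hbelow _ Q s) lam).trans hlam
  rw [← div_le_iff₀' hC]
  refine le_of_forall_gt_imp_ge_of_dense fun N hN => ?_
  rw [div_le_iff₀' hC]
  exact key N hN
end
end
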